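/- Let u ∈ C^∞(S²) be a solution of −Δu + 3 = e^{2u} on S². If there exists a point p ∈ S² such that ∇u(p) = 0 and the Hessian D²u(p) has two equal eigenvalues, then u is a constant function (necessarily u ≡ (1/2)·log 3). -/

import Mathlib

open MeasureTheory Real
open scoped RealInnerProductSpace ContDiff

noncomputable section

abbrev E3 : Type := EuclideanSpace ℝ (Fin 3)

/-- The unit sphere `S²` as a subset of `ℝ³`. -/
def S2 : Set E3 := Metric.sphere 0 1

/-- The Euclidean Laplacian of `u : ℝ³ → ℝ`.  For a `0`-homogeneous function it
coincides on `S²` with the Laplace–Beltrami operator of the round metric applied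
to the restriction of `u` to `S²`. -/
def lap (u : E3 → ℝ) (x : E3) : ℝ :=
  ∑ i : Fin 3, iteratedFDeriv ℝ 2 u x ![EuclideanSpace.single i 1, EuclideanSpace.single i 1]

/-- `u : ℝ³ → ℝ` is positively homogeneous of degree `0`, i.e. it is the radial
extension of a function on `S²`. -/
def Hom0 (u : E3 → ℝ) : Prop := ∀ (x : E3) (r : ℝ), 0 < r → u (r • x) = u x

/-- `u` represents a smooth solution of the mean field equation `-Δ_{S²} u + α = e^{2u}`
on `S²`, encoded through its degree-zero homogeneous extension to `ℝ³ \ {0}`. -/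
def MFE (u : E3 → ℝ) (α : ℝ) : Prop :=
  ContDiffOn ℝ ∞ u {(0 : E3)}ᶜ ∧ Hom0 u ∧
    ∀ x ∈ S2, -lap u x + α = Real.exp (2 * u x)

/-- Reflection of `ℝ³` across the plane `{x · y = 0}`. -/
def Refl (y x : E3) : E3 := x - (2 * ⟪x, y⟫) • y

/-- The closed half-sphere `H_y`. -/
def halfSphere (y : E3) : Set E3 := {x ∈ S2 | 0 ≤ ⟪x, y⟫}

/-- The great circle `C_y`. -/
def circleOf (y : E3) : Set E3 := {x ∈ S2 | ⟪x, y⟫ = 0}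

/-- `u` is axially symmetric with respect to `p`: on the sphere it depends only on `x · p`. -/
def AxiallySymmetric (u : E3 → ℝ) (p : E3) : Prop :=
  ∀ x ∈ S2, ∀ y ∈ S2, ⟪x, p⟫ = ⟪y, p⟫ → u x = u y

/-- `p` is an umbilical critical point of `u` (viewed as a function on `S²`):
the (intrinsic) gradient vanishes and the Hessian, as a quadratic form on the
tangent plane `p^⊥`, is a multiple of the metric. -/
def UmbilicalCritical (u : E3 → ℝ) (p : E3) : Prop :=
  fderiv ℝ u p = 0 ∧
    ∃ c : ℝ, ∀ v : E3, ⟪v, p⟫ = 0 → iteratedFDeriv ℝ 2 u p ![v, v] = c * ‖v‖ ^ 2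

/-- `z` is an eigenvector of the Hessian `D²u(q)` viewed as a symmetric bilinear
form on the tangent plane `q^⊥`. -/
def HessEigen (u : E3 → ℝ) (q z : E3) : Prop :=
  ∃ lam : ℝ, ∀ v : E3, ⟪v, q⟫ = 0 → iteratedFDeriv ℝ 2 u q ![z, v] = lam * ⟪z, v⟫

/-- Cross product on `ℝ³`. -/
def cross (a b : E3) : E3 :=
  (WithLp.equiv 2 (Fin 3 → ℝ)).symm
    (crossProduct ((WithLp.equiv 2 (Fin 3 → ℝ)) a) ((WithLp.equiv 2 (Fin 3 → ℝ)) b))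

/-- `Ω` is a nodal domain of `w` on the sphere: a connected component of
`S² \ w⁻¹(0)` (in the subspace topology of `S²`). -/
def IsNodalDomain (w : E3 → ℝ) (Ω : Set E3) : Prop :=
  ∃ x ∈ S2, w x ≠ 0 ∧ Ω = connectedComponentIn {z ∈ S2 | w z ≠ 0} x

end

/-!
### Outline

Two solutions that agree to high order at prescribed points of the sphere are equal: this follows
from a maximum principle for a barrier built from their difference. Comparing a solution with its
reflections, a third-order analysis at the umbilical critical point `p` shows that `-p` is also
umbilical and critical, and then that the solution is axially symmetric about `p`. A Pohozaev-type
identity for the resulting ordinary differential equation forces the solution to be constant.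
-/

namespace MeanField

open Filter Topology

noncomputable section

section

/-- The directional derivative of `f` in the direction `v`. -/
def dd (v : E3) (f : E3 → ℝ) : E3 → ℝ := fun x => fderiv ℝ f x v

/-- `f` is smooth in a neighbourhood of `x`. -/
def Sm (f : E3 → ℝ) (x : E3) : Prop := ∀ᶠ y in 𝓝 x, ContDiffAt ℝ ∞ f y

variable {f g : E3 → ℝ} {x v w : E3}

protected theorem Sm.contDiffAt (h : Sm f x) : ContDiffAt ℝ ∞ f x := h.self_of_nhds

protected theorem Sm.differentiableAt (h : Sm f x) : DifferentiableAt ℝ f x :=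
  h.contDiffAt.differentiableAt (by simp)

protected theorem Sm.nhds (h : Sm f x) : ∀ᶠ y in 𝓝 x, Sm f y := h.eventually_nhds

protected theorem Sm.congr (h : Sm f x) (hfg : g =ᶠ[𝓝 x] f) : Sm g x := by
  filter_upwards [h, hfg.eventually_nhds] with y hy hy'
  exact hy.congr_of_eventuallyEq hy'

protected theorem Sm.fderiv (h : Sm f x) : ContDiffAt ℝ ∞ (fderiv ℝ f) x :=
  h.contDiffAt.fderiv_right (m := ∞) (by simp)

protected theorem Sm.dd (h : Sm f x) (v : E3) : Sm (dd v f) x := by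
  filter_upwards [h] with y hy
  exact (hy.fderiv_right (m := ∞) (by simp)).clm_apply contDiffAt_const

protected theorem Sm.add (hf : Sm f x) (hg : Sm g x) : Sm (fun y => f y + g y) x := by
  filter_upwards [hf, hg] with y h1 h2 using h1.add h2

protected theorem Sm.sub (hf : Sm f x) (hg : Sm g x) : Sm (fun y => f y - g y) x := by
  filter_upwards [hf, hg] with y h1 h2 using h1.sub h2

protected theorem Sm.mul (hf : Sm f x) (hg : Sm g x) : Sm (fun y => f y * g y) x := by
  filter_upwards [hf, hg] with y h1 h2 using h1.mul h2

protected theorem Sm.neg (hf : Sm f x) : Sm (fun y => - f y) x := by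
  filter_upwards [hf] with y h1 using h1.neg

protected theorem Sm.const (c : ℝ) : Sm (fun _ => c) x :=
  Eventually.of_forall fun _ => contDiffAt_const

protected theorem Sm.sum {ι : Type*} {s : Finset ι} {F : ι → E3 → ℝ} (h : ∀ i ∈ s, Sm (F i) x) :
    Sm (fun y => ∑ i ∈ s, F i y) x := by
  have := (Finset.eventually_all s).2 h
  filter_upwards [this] with y hy using ContDiffAt.sum hy

protected theorem Sm.inner_left (v : E3) : Sm (fun y => ⟪y, v⟫) x :=
  Eventually.of_forall fun _ => contDiffAt_id.inner ℝ contDiffAt_const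

protected theorem Sm.normSq : Sm (fun y => ‖y‖ ^ 2) x :=
  Eventually.of_forall fun _ => (contDiff_norm_sq ℝ).contDiffAt

protected theorem Sm.comp {φ : ℝ → ℝ} (hφ : ∀ᶠ t in 𝓝 (f x), ContDiffAt ℝ ∞ φ t) (hf : Sm f x) :
    Sm (fun y => φ (f y)) x := by
  filter_upwards [hf, hf.contDiffAt.continuousAt.eventually hφ] with y h1 h2
  exact h2.comp y h1

/-! ### First derivatives -/

theorem dd_congr (h : f =ᶠ[𝓝 x] g) : dd v f =ᶠ[𝓝 x] dd v g := by
  filter_upwards [h.eventually_nhds] with y hy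
  simp only [dd, Filter.EventuallyEq.fderiv_eq hy]

theorem dd_congr_at (h : f =ᶠ[𝓝 x] g) : dd v f x = dd v g x := (dd_congr h).self_of_nhds

theorem dd_add (hf : Sm f x) (hg : Sm g x) :
    dd v (fun y => f y + g y) x = dd v f x + dd v g x := by
  simp only [dd]; rw [fderiv_fun_add hf.differentiableAt hg.differentiableAt]; rfl

theorem dd_sub (hf : Sm f x) (hg : Sm g x) :
    dd v (fun y => f y - g y) x = dd v f x - dd v g x := by
  simp only [dd]; rw [fderiv_fun_sub hf.differentiableAt hg.differentiableAt]; rfl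

theorem dd_neg : dd v (fun y => - f y) x = - dd v f x := by
  simp only [dd]; rw [fderiv_fun_neg]; rfl

theorem dd_const (c : ℝ) : dd v (fun _ => c) x = 0 := by
  simp [dd]

theorem dd_mul (hf : Sm f x) (hg : Sm g x) :
    dd v (fun y => f y * g y) x = f x * dd v g x + g x * dd v f x := by
  simp only [dd]; rw [fderiv_fun_mul hf.differentiableAt hg.differentiableAt]; rfl

theorem dd_const_mul (c : ℝ) (hf : Sm f x) : dd v (fun y => c * f y) x = c * dd v f x := by
  rw [dd_mul (Sm.const c) hf, dd_const]; ring

theorem dd_sum {ι : Type*} {s : Finset ι} {F : ι → E3 → ℝ} (h : ∀ i ∈ s, Sm (F i) x) :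
    dd v (fun y => ∑ i ∈ s, F i y) x = ∑ i ∈ s, dd v (F i) x := by
  simp only [dd]
  rw [fderiv_fun_sum fun i hi => (h i hi).differentiableAt]; simp

theorem dd_comp {φ : ℝ → ℝ} (hφ : DifferentiableAt ℝ φ (f x)) (hf : DifferentiableAt ℝ f x) :
    dd v (fun y => φ (f y)) x = deriv φ (f x) * dd v f x := by
  simp only [dd]
  have := (hφ.hasDerivAt.comp_hasFDerivAt x hf.hasFDerivAt).fderiv
  rw [show (fun y => φ (f y)) = φ ∘ f from rfl, this]; simp

theorem dd_inner_left (a : E3) : dd v (fun y => ⟪y, a⟫) x = ⟪v, a⟫ := by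
  have : HasFDerivAt (fun y : E3 => ⟪y, a⟫) (innerSL ℝ a) x := by
    have := (innerSL ℝ a).hasFDerivAt (x := x)
    refine this.congr_of_eventuallyEq (Eventually.of_forall fun y => ?_)
    simp [real_inner_comm]
  simp only [dd]; rw [this.fderiv]; simp [real_inner_comm]

theorem dd_normSq : dd v (fun y => ‖y‖ ^ 2) x = 2 * ⟪x, v⟫ := by
  simp only [dd]; rw [(hasStrictFDerivAt_norm_sq x).hasFDerivAt.fderiv]; simp

theorem dd_vadd (f : E3 → ℝ) (v w x : E3) : dd (v + w) f x = dd v f x + dd w f x := by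
  simp [dd]

theorem dd_smul (f : E3 → ℝ) (c : ℝ) (v x : E3) : dd (c • v) f x = c * dd v f x := by
  simp [dd]

theorem dd_basis (b : OrthonormalBasis (Fin 3) ℝ E3) (f : E3 → ℝ) (v x : E3) :
    dd v f x = ∑ i, ⟪b i, v⟫ * dd (b i) f x := by
  conv_lhs => rw [← b.sum_repr' v]
  simp [dd]

/-! ### Second derivatives -/

theorem dd_dd (h : Sm f x) : dd v (dd w f) x = fderiv ℝ (fderiv ℝ f) x v w := by
  have := (h.fderiv.differentiableAt (by simp)).hasFDerivAt.clm_apply (hasFDerivAt_const w x)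
  have e : dd w f = fun y => fderiv ℝ f y w := rfl
  rw [e]
  conv_lhs => simp only [dd]
  rw [this.fderiv]
  simp

theorem iteratedFDeriv_two_eq (h : Sm f x) :
    iteratedFDeriv ℝ 2 f x ![v, w] = dd v (dd w f) x := by
  rw [dd_dd h, iteratedFDeriv_two_apply]; simp

theorem dd_comm (h : Sm f x) : dd v (dd w f) x = dd w (dd v f) x := by
  rw [dd_dd h, dd_dd h]
  exact (h.contDiffAt.isSymmSndFDerivAt
    (by simpa using WithTop.coe_le_coe.2 (le_top : (2 : ℕ∞) ≤ ⊤))).eq v w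

theorem dd_comm_eventually (h : Sm f x) : dd v (dd w f) =ᶠ[𝓝 x] dd w (dd v f) := by
  filter_upwards [h.nhds] with y hy using dd_comm hy

theorem lap_eq (b : OrthonormalBasis (Fin 3) ℝ E3) (h : Sm f x) :
    lap f x = ∑ i, dd (b i) (dd (b i) f) x := by
  have h1 := congrFun (InnerProductSpace.laplacian_eq_iteratedFDeriv_orthonormalBasis f
    (EuclideanSpace.basisFun (Fin 3) ℝ)) x
  have h2 := congrFun (InnerProductSpace.laplacian_eq_iteratedFDeriv_orthonormalBasis f b) x
  rw [h1] at h2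
  simp only [← iteratedFDeriv_two_eq h]
  rw [← h2]; simp [lap]

theorem lap_congr (h : f =ᶠ[𝓝 x] g) : lap f x = lap g x := by
  simp only [lap]
  rw [(Filter.EventuallyEq.iteratedFDeriv ℝ h 2).self_of_nhds]

variable (b : OrthonormalBasis (Fin 3) ℝ E3)

theorem dd_dd_add (hf : Sm f x) (hg : Sm g x) :
    dd v (dd w (fun y => f y + g y)) x = dd v (dd w f) x + dd v (dd w g) x := by
  rw [← dd_add (hf.dd w) (hg.dd w)]
  apply dd_congr_at
  filter_upwards [hf.nhds, hg.nhds] with y h1 h2 using dd_add h1 h2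

theorem dd_dd_sub (hf : Sm f x) (hg : Sm g x) :
    dd v (dd w (fun y => f y - g y)) x = dd v (dd w f) x - dd v (dd w g) x := by
  rw [← dd_sub (hf.dd w) (hg.dd w)]
  apply dd_congr_at
  filter_upwards [hf.nhds, hg.nhds] with y h1 h2 using dd_sub h1 h2

theorem dd_dd_mul (hf : Sm f x) (hg : Sm g x) :
    dd v (dd w (fun y => f y * g y)) x = f x * dd v (dd w g) x + dd v f x * dd w g x
      + dd w f x * dd v g x + g x * dd v (dd w f) x := by
  have : dd w (fun y => f y * g y) =ᶠ[𝓝 x] fun y => f y * dd w g y + g y * dd w f y := by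
    filter_upwards [hf.nhds, hg.nhds] with y h1 h2 using dd_mul h1 h2
  rw [dd_congr_at this, dd_add (hf.mul (hg.dd w)) (hg.mul (hf.dd w)), dd_mul hf (hg.dd w),
    dd_mul hg (hf.dd w)]
  ring

theorem dd_dd_comp {φ : ℝ → ℝ} (hφ : ∀ᶠ t in 𝓝 (f x), ContDiffAt ℝ ∞ φ t) (hf : Sm f x) :
    dd v (dd w (fun y => φ (f y))) x = deriv (deriv φ) (f x) * (dd v f x * dd w f x)
      + deriv φ (f x) * dd v (dd w f) x := by
  have h' : ContDiffAt ℝ ∞ (deriv φ) (f x) := hφ.self_of_nhds.derivWithin (by simp)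
  have h1 : dd w (fun y => φ (f y)) =ᶠ[𝓝 x] fun y => deriv φ (f y) * dd w f y := by
    filter_upwards [hf.nhds, hf.contDiffAt.continuousAt.eventually hφ] with y h1 h2
    exact dd_comp (h2.differentiableAt (by simp)) h1.differentiableAt
  have h2 : Sm (fun y => deriv φ (f y)) x := by
    refine Sm.comp ?_ hf
    filter_upwards [hφ] with t ht using ht.derivWithin (by simp)
  rw [dd_congr_at h1, dd_mul h2 (hf.dd w),
    dd_comp (h'.differentiableAt (by simp)) hf.differentiableAt]
  ring

theorem lap_add (hf : Sm f x) (hg : Sm g x) :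
    lap (fun y => f y + g y) x = lap f x + lap g x := by
  let b := EuclideanSpace.basisFun (Fin 3) ℝ
  rw [lap_eq b hf, lap_eq b hg, lap_eq b (hf.add hg), ← Finset.sum_add_distrib]
  exact Finset.sum_congr rfl fun i _ => dd_dd_add hf hg

theorem lap_sub (hf : Sm f x) (hg : Sm g x) :
    lap (fun y => f y - g y) x = lap f x - lap g x := by
  let b := EuclideanSpace.basisFun (Fin 3) ℝ
  rw [lap_eq b hf, lap_eq b hg, lap_eq b (hf.sub hg), ← Finset.sum_sub_distrib]
  exact Finset.sum_congr rfl fun i _ => dd_dd_sub hf hg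

theorem lap_const (c : ℝ) : lap (fun _ => c) x = 0 := by
  rw [lap_eq (EuclideanSpace.basisFun (Fin 3) ℝ) (Sm.const c)]
  refine Finset.sum_eq_zero fun i _ => ?_
  have : dd (EuclideanSpace.basisFun (Fin 3) ℝ i) (fun _ : E3 => c) = fun _ => 0 :=
    funext fun y => dd_const c
  rw [this, dd_const]

theorem lap_sum {ι : Type*} (s : Finset ι) {F : ι → E3 → ℝ} (h : ∀ i ∈ s, Sm (F i) x) :
    lap (fun y => ∑ i ∈ s, F i y) x = ∑ i ∈ s, lap (F i) x := by
  classical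
  induction s using Finset.induction_on with
  | empty => simpa using lap_const 0
  | insert a s ha ih =>
    simp only [Finset.sum_insert ha]
    rw [lap_add (h a (by simp)) (Sm.sum fun i hi => h i (by simp [hi])),
      ih fun i hi => h i (by simp [hi])]

theorem lap_mul (hf : Sm f x) (hg : Sm g x) :
    lap (fun y => f y * g y) x =
      f x * lap g x + 2 * ∑ i, dd (b i) f x * dd (b i) g x + g x * lap f x := by
  rw [lap_eq b hf, lap_eq b hg, lap_eq b (hf.mul hg), Finset.mul_sum, Finset.mul_sum,
    Finset.mul_sum, ← Finset.sum_add_distrib, ← Finset.sum_add_distrib]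
  exact Finset.sum_congr rfl fun i _ => by rw [dd_dd_mul hf hg]; ring

theorem lap_const_mul (c : ℝ) (hf : Sm f x) : lap (fun y => c * f y) x = c * lap f x := by
  rw [lap_mul (EuclideanSpace.basisFun (Fin 3) ℝ) (Sm.const c) hf, lap_const]
  simp [dd_const]

theorem lap_comp {φ : ℝ → ℝ} (hφ : ∀ᶠ t in 𝓝 (f x), ContDiffAt ℝ ∞ φ t) (hf : Sm f x) :
    lap (fun y => φ (f y)) x = deriv (deriv φ) (f x) * ∑ i, dd (b i) f x ^ 2
      + deriv φ (f x) * lap f x := by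
  rw [lap_eq b hf, lap_eq b (Sm.comp hφ hf), Finset.mul_sum, Finset.mul_sum,
    ← Finset.sum_add_distrib]
  exact Finset.sum_congr rfl fun i _ => by rw [dd_dd_comp hφ hf]; ring

theorem lap_inner_left (a : E3) : lap (fun y => ⟪y, a⟫) x = 0 := by
  rw [lap_eq (EuclideanSpace.basisFun (Fin 3) ℝ) (Sm.inner_left a)]
  refine Finset.sum_eq_zero fun i _ => ?_
  have : dd (EuclideanSpace.basisFun (Fin 3) ℝ i) (fun y : E3 => ⟪y, a⟫) =
      fun _ => ⟪EuclideanSpace.basisFun (Fin 3) ℝ i, a⟫ := funext fun y => dd_inner_left a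
  rw [this, dd_const]

theorem lap_normSq : lap (fun y => ‖y‖ ^ 2) x = 6 := by
  let b := EuclideanSpace.basisFun (Fin 3) ℝ
  rw [lap_eq b Sm.normSq]
  have : ∀ i, dd (b i) (dd (b i) (fun y : E3 => ‖y‖ ^ 2)) x = 2 := fun i => by
    have : dd (b i) (fun y : E3 => ‖y‖ ^ 2) = fun y => 2 * ⟪y, b i⟫ :=
      funext fun y => dd_normSq
    rw [this, dd_const_mul _ (Sm.inner_left _), dd_inner_left]
    simp
  simp only [this]; norm_num

/-- At a local maximum the Laplacian is nonpositive. -/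
theorem lap_nonpos_of_isLocalMax (hf : Sm f x) (h : IsLocalMax f x) : lap f x ≤ 0 := by
  let b := EuclideanSpace.basisFun (Fin 3) ℝ
  rw [lap_eq b hf]
  refine Finset.sum_nonpos fun i _ => ?_
  by_contra! hpos
  let γ : ℝ → E3 := fun t => x + t • b i
  have hγ : ∀ t, HasDerivAt γ (b i) t := fun t => by
    simpa [γ] using (hasDerivAt_id t).smul_const (b i)
  have hγ0 : γ 0 = x := by simp [γ]
  have hγt : Tendsto γ (𝓝 0) (𝓝 x) := by
    have := (hγ 0).continuousAt.tendsto; rwa [hγ0] at this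
  have hd : ∀ {F : E3 → ℝ} {t : ℝ}, DifferentiableAt ℝ F (γ t) →
      HasDerivAt (fun s => F (γ s)) (dd (b i) F (γ t)) t := fun {F t} hF =>
    hF.hasFDerivAt.comp_hasDerivAt t (hγ t)
  have h1 : deriv (fun s => f (γ s)) =ᶠ[𝓝 0] fun s => dd (b i) f (γ s) := by
    filter_upwards [hγt.eventually hf] with t ht
    exact (hd (ht.differentiableAt (by simp))).deriv
  have h2 : deriv (deriv fun s => f (γ s)) 0 = dd (b i) (dd (b i) f) x := by
    rw [h1.deriv_eq]
    have := (hd (t := 0) (F := dd (b i) f) (by rw [hγ0]; exact (hf.dd _).differentiableAt)).deriv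
    rw [this, hγ0]
  have hmax : IsLocalMax (fun s => f (γ s)) 0 := by
    have : ∀ᶠ y in 𝓝 x, f y ≤ f (γ 0) := by rw [hγ0]; exact h
    exact hγt.eventually this
  have hd0 : deriv (fun s => f (γ s)) 0 = 0 := hmax.deriv_eq_zero
  have hmin : IsLocalMin (fun s => f (γ s)) 0 := by
    refine isLocalMin_of_deriv_deriv_pos (by rw [h2]; exact hpos) hd0 ?_
    exact (hd (t := 0) (by rw [hγ0]; exact hf.differentiableAt)).continuousAt
  have heq : (fun s => f (γ s)) =ᶠ[𝓝 0] fun _ => f (γ 0) := by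
    filter_upwards [hmin, hmax] with t h1 h2 using le_antisymm h2 h1
  have : deriv (deriv fun s => f (γ s)) 0 = 0 := by
    rw [heq.deriv.deriv_eq]; simp
  linarith

end

section

variable {f g : E3 → ℝ} {x v w : E3}

/-! ### Homogeneous functions -/

theorem dd_smul_of_homogeneous {φ r : ℝ} (hr : r ≠ 0) (h : ∀ y, f (r • y) = φ * f y) (v x : E3) :
    dd v f (r • x) = r⁻¹ * φ * dd v f x := by
  have h1 : fderiv ℝ (fun y => f (r • y)) x = r • fderiv ℝ f (r • x) := fderiv_comp_smul ..
  have h2 : fderiv ℝ (fun y => f (r • y)) x = φ • fderiv ℝ f x := by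
    simp_rw [h]
    simpa using! congrFun (fderiv_const_smul_field (𝕜 := ℝ) (f := f) φ) x
  rw [h1] at h2
  have := congrArg (fun L => r⁻¹ * L v) h2
  simp only [dd]
  simp only [smul_apply, smul_eq_mul] at this
  rw [inv_mul_cancel_left₀ hr] at this
  rw [this]; ring

protected theorem Hom0.dd_smul (h : Hom0 f) {r : ℝ} (hr : 0 < r) (v x : E3) :
    dd v f (r • x) = r⁻¹ * dd v f x := by
  simpa using dd_smul_of_homogeneous (φ := 1) hr.ne' (fun y => by rw [h y r hr, one_mul]) v x

protected theorem Hom0.dd_dd_smul (h : Hom0 f) {r : ℝ} (hr : 0 < r) (v w x : E3) :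
    dd v (dd w f) (r • x) = r⁻¹ * r⁻¹ * dd v (dd w f) x :=
  dd_smul_of_homogeneous hr.ne' (fun y => Hom0.dd_smul h hr w y) v x

theorem dd_self_of_homogeneous {φ : ℝ → ℝ} {φ' : ℝ} (hφ : HasDerivAt φ φ' 1)
    (hf : DifferentiableAt ℝ f x) (h : ∀ r : ℝ, 0 < r → f (r • x) = φ r * f x) :
    dd x f x = φ' * f x := by
  have h1 : HasDerivAt (fun r : ℝ => r • x) x 1 := by
    simpa using (hasDerivAt_id (1 : ℝ)).smul_const x
  have h2 : HasDerivAt (fun r : ℝ => f (r • x)) (dd x f x) 1 := by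
    have := hf.hasFDerivAt
    rw [← one_smul ℝ x] at this
    have := this.comp_hasDerivAt (1 : ℝ) h1
    simpa [dd] using! this
  have h3 : HasDerivAt (fun r : ℝ => f (r • x)) (φ' * f x) 1 := by
    refine (hφ.mul_const (f x)).congr_of_eventuallyEq ?_
    filter_upwards [eventually_gt_nhds (zero_lt_one (α := ℝ))] with r hr using h r hr
  exact h2.unique h3

protected theorem Hom0.euler (h : Hom0 f) (hf : Sm f x) : dd x f x = 0 := by
  have := dd_self_of_homogeneous (hasDerivAt_const 1 1) hf.differentiableAt
    fun r hr => by rw [h x r hr, one_mul]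
  simpa using this

protected theorem Hom0.euler_dd (h : Hom0 f) (hf : Sm f x) (v : E3) :
    dd x (dd v f) x = - dd v f x := by
  have := dd_self_of_homogeneous (φ := fun r => r⁻¹) (by simpa using hasDerivAt_inv one_ne_zero)
    (hf.dd v).differentiableAt fun r hr => Hom0.dd_smul h hr v x
  simpa using this

theorem smooth_nhds (h : ∀ x ≠ 0, ContDiffAt ℝ ∞ f x) (hx : x ≠ 0) : Sm f x := by
  filter_upwards [isOpen_ne.mem_nhds hx] with y hy using h y hy

/-! ### Solutions -/

/-- The `0`-homogeneous extension of a solution of `-Δu + 3 = e^{2u}` on the sphere. -/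
structure Sol (u : E3 → ℝ) : Prop where
  smooth : ∀ x ≠ 0, ContDiffAt ℝ ∞ u x
  hom : Hom0 u
  eq : ∀ x ≠ 0, ‖x‖ ^ 2 * lap u x = 3 - exp (2 * u x)

theorem Sol.sm {u : E3 → ℝ} (h : Sol u) (hx : x ≠ 0) : Sm u x := smooth_nhds h.smooth hx

protected theorem Hom0.lap_smul (h : Hom0 f) (hf : ∀ x ≠ 0, Sm f x) {r : ℝ} (hr : 0 < r)
    (hx : x ≠ 0) :
    lap f (r • x) = r⁻¹ * r⁻¹ * lap f x := by
  let b := EuclideanSpace.basisFun (Fin 3) ℝ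
  rw [lap_eq b (hf x hx), lap_eq b (hf _ (smul_ne_zero hr.ne' hx)), Finset.mul_sum]
  exact Finset.sum_congr rfl fun i _ => Hom0.dd_dd_smul h hr _ _ _

theorem Sol.of_MFE {u : E3 → ℝ} (h : MFE u 3) : Sol u := by
  obtain ⟨hs, hh, he⟩ := h
  have hs' : ∀ x ≠ 0, ContDiffAt ℝ ∞ u x := fun x hx =>
    hs.contDiffAt (isOpen_compl_singleton.mem_nhds hx)
  refine ⟨hs', hh, fun x hx => ?_⟩
  have hn : 0 < ‖x‖ := norm_pos_iff.2 hx
  have hx1 : ‖x‖⁻¹ • x ∈ S2 := by simp [S2, norm_smul, hn.ne']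
  have := he _ hx1
  rw [hh x _ (inv_pos.2 hn), Hom0.lap_smul hh (fun y hy => smooth_nhds hs' hy) (inv_pos.2 hn) hx,
    inv_inv] at this
  linarith

theorem dd_comp_isometry (R : E3 ≃ₗᵢ[ℝ] E3) (f : E3 → ℝ) (v : E3) :
    dd v (fun y => f (R y)) = fun y => dd (R v) f (R y) := by
  funext y
  have := R.toContinuousLinearEquiv.comp_right_fderiv (f := f) (x := y)
  have h2 := congrArg (fun L => L v) this
  simpa [dd] using! h2

protected theorem Sm.comp_isometry (R : E3 ≃ₗᵢ[ℝ] E3) (h : Sm f (R x)) :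
    Sm (fun y => f (R y)) x := by
  filter_upwards [R.continuous.continuousAt.eventually h] with y hy
  exact hy.comp y R.contDiff.contDiffAt

theorem lap_comp_isometry (R : E3 ≃ₗᵢ[ℝ] E3) (h : Sm f (R x)) :
    lap (fun y => f (R y)) x = lap f (R x) := by
  let b := EuclideanSpace.basisFun (Fin 3) ℝ
  rw [lap_eq b (h.comp_isometry R), lap_eq (b.map R) h]
  refine Finset.sum_congr rfl fun i _ => ?_
  rw [dd_comp_isometry, dd_comp_isometry, OrthonormalBasis.map_apply]

theorem Sol.comp_isometry {u : E3 → ℝ} (h : Sol u) (R : E3 ≃ₗᵢ[ℝ] E3) :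
    Sol fun y => u (R y) := by
  have hR : ∀ x ≠ 0, R x ≠ 0 := fun x hx => by simpa using hx
  refine ⟨fun x hx => ((h.sm (hR x hx)).comp_isometry R).contDiffAt, fun x r hr => ?_,
    fun x hx => ?_⟩
  · simp only [map_smul]; exact h.hom _ r hr
  · rw [lap_comp_isometry R (h.sm (hR x hx)), ← h.eq _ (hR x hx), R.norm_map]

protected theorem Hom0.sub (hf : Hom0 f) (hg : Hom0 g) : Hom0 fun y => f y - g y := fun x r hr => by
  simp only [hf x r hr, hg x r hr]

protected theorem Hom0.add (hf : Hom0 f) (hg : Hom0 g) : Hom0 fun y => f y + g y := fun x r hr => by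
  simp only [hf x r hr, hg x r hr]

/-- The squared norm of the gradient. -/
def gs (f : E3 → ℝ) (x : E3) : ℝ := ‖gradient f x‖ ^ 2

theorem gs_eq (b : OrthonormalBasis (Fin 3) ℝ E3) (f : E3 → ℝ) (x : E3) :
    gs f x = ∑ i, dd (b i) f x * dd (b i) f x := by
  rw [gs, ← b.sum_sq_norm_inner_right]
  refine Finset.sum_congr rfl fun i _ => ?_
  have : dd (b i) f x = ⟪b i, gradient f x⟫ := by
    rw [real_inner_comm]; simp [dd, gradient]
  rw [this, Real.norm_eq_abs, sq_abs, sq]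

protected theorem Sm.gs (h : Sm f x) : Sm (gs f) x := by
  have : MeanField.gs f = fun y => ∑ i, dd (EuclideanSpace.basisFun (Fin 3) ℝ i) f y *
      dd (EuclideanSpace.basisFun (Fin 3) ℝ i) f y := funext fun y => gs_eq _ f y
  rw [this]
  exact Sm.sum fun i _ => (h.dd _).mul (h.dd _)

protected theorem Hom0.gs_smul (h : Hom0 f) {r : ℝ} (hr : 0 < r) (x : E3) :
    gs f (r • x) = r⁻¹ * r⁻¹ * gs f x := by
  simp only [gs_eq (EuclideanSpace.basisFun (Fin 3) ℝ), Hom0.dd_smul h hr, Finset.mul_sum]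
  exact Finset.sum_congr rfl fun i _ => by ring

/-- `2 cosh (u₁ - u₂) - 2`. -/
def AA (u₁ u₂ : E3 → ℝ) (y : E3) : ℝ := 2 * cosh (u₁ y - u₂ y) - 2

/-- The comparison quantity `e^{-(u₁ + u₂)} |∇(u₁ - u₂)|² + 2 cosh (u₁ - u₂) - 2`,
extended `0`-homogeneously. -/
def NN (u₁ u₂ : E3 → ℝ) (y : E3) : ℝ :=
  (‖y‖ ^ 2 * exp (-(u₁ y + u₂ y))) * gs (fun z => u₁ z - u₂ z) y + AA u₁ u₂ y

theorem AA_nonneg (u₁ u₂ : E3 → ℝ) (y : E3) : 0 ≤ AA u₁ u₂ y := by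
  have := one_le_cosh (u₁ y - u₂ y); simp only [AA]; linarith

theorem NN_nonneg (u₁ u₂ : E3 → ℝ) (y : E3) : 0 ≤ NN u₁ u₂ y := by
  have := AA_nonneg u₁ u₂ y
  have : 0 ≤ gs (fun z => u₁ z - u₂ z) y := sq_nonneg _
  simp only [NN]; positivity

theorem eventually_cosh (t : ℝ) : ∀ᶠ s in 𝓝 t, ContDiffAt ℝ ∞ cosh s :=
  Eventually.of_forall fun _ => contDiff_cosh.contDiffAt

theorem eventually_exp (t : ℝ) : ∀ᶠ s in 𝓝 t, ContDiffAt ℝ ∞ exp s :=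
  Eventually.of_forall fun _ => contDiff_exp.contDiffAt

theorem eventually_sinh (t : ℝ) : ∀ᶠ s in 𝓝 t, ContDiffAt ℝ ∞ sinh s :=
  Eventually.of_forall fun _ => contDiff_sinh.contDiffAt

section pair

variable {u₁ u₂ : E3 → ℝ}

protected theorem Sm.AA (h1 : Sm u₁ x) (h2 : Sm u₂ x) : Sm (AA u₁ u₂) x :=
  ((Sm.const 2).mul ((h1.sub h2).comp (eventually_cosh _))).sub (Sm.const 2)

protected theorem Sm.NN (h1 : Sm u₁ x) (h2 : Sm u₂ x) : Sm (NN u₁ u₂) x :=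
  ((Sm.normSq.mul ((h1.add h2).neg.comp (eventually_exp _))).mul (h1.sub h2).gs).add (h1.AA h2)

protected theorem Hom0.AA (h1 : Hom0 u₁) (h2 : Hom0 u₂) : Hom0 (AA u₁ u₂) := fun x r hr => by
  simp only [MeanField.AA, h1 x r hr, h2 x r hr]

protected theorem Hom0.NN (h1 : Hom0 u₁) (h2 : Hom0 u₂) : Hom0 (NN u₁ u₂) := fun x r hr => by
  simp only [MeanField.NN, Hom0.AA h1 h2 x r hr, h1 x r hr, h2 x r hr,
    Hom0.gs_smul (Hom0.sub h1 h2) hr, norm_smul, Real.norm_of_nonneg hr.le]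
  field_simp

theorem Sol.lap_sub_eq (h1 : Sol u₁) (h2 : Sol u₂) (hx : x ≠ 0) :
    ‖x‖ ^ 2 * lap (fun y => u₁ y - u₂ y) x = -2 * (exp (u₁ x + u₂ x) * sinh (u₁ x - u₂ x)) := by
  rw [lap_sub (h1.sm hx) (h2.sm hx), mul_sub, h1.eq x hx, h2.eq x hx, sinh_eq]
  have e1 : exp (2 * u₁ x) = exp (u₁ x + u₂ x) * exp (u₁ x - u₂ x) := by
    rw [← exp_add]; ring_nf
  have e2 : exp (2 * u₂ x) = exp (u₁ x + u₂ x) * exp (-(u₁ x - u₂ x)) := by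
    rw [← exp_add]; ring_nf
  rw [e1, e2]; ring

theorem Sol.lap_add_eq (h1 : Sol u₁) (h2 : Sol u₂) (hx : x ≠ 0) :
    ‖x‖ ^ 2 * lap (fun y => u₁ y + u₂ y) x = 6 - 2 * (exp (u₁ x + u₂ x) * cosh (u₁ x - u₂ x)) := by
  rw [lap_add (h1.sm hx) (h2.sm hx), mul_add, h1.eq x hx, h2.eq x hx, cosh_eq]
  have e1 : exp (2 * u₁ x) = exp (u₁ x + u₂ x) * exp (u₁ x - u₂ x) := by
    rw [← exp_add]; ring_nf
  have e2 : exp (2 * u₂ x) = exp (u₁ x + u₂ x) * exp (-(u₁ x - u₂ x)) := by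
    rw [← exp_add]; ring_nf
  rw [e1, e2]; ring

end pair

end

section

variable {f g : E3 → ℝ} {x v w : E3}

section pair

variable {u₁ u₂ : E3 → ℝ}

theorem dd_AA (h1 : Sm u₁ x) (h2 : Sm u₂ x) (v : E3) :
    dd v (AA u₁ u₂) x = 2 * (sinh (u₁ x - u₂ x) * dd v (fun y => u₁ y - u₂ y) x) := by
  have hw := h1.sub h2
  have e : AA u₁ u₂ = fun y => 2 * cosh (u₁ y - u₂ y) - 2 := rfl
  rw [e, dd_sub ((Sm.const 2).mul (hw.comp (eventually_cosh _))) (Sm.const 2),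
    dd_const_mul 2 (hw.comp (eventually_cosh _)), dd_const,
    dd_comp differentiable_cosh.differentiableAt
    hw.differentiableAt, Real.deriv_cosh]
  ring

theorem lap_AA (b : OrthonormalBasis (Fin 3) ℝ E3) (h1 : Sm u₁ x) (h2 : Sm u₂ x) :
    lap (AA u₁ u₂) x = 2 * (cosh (u₁ x - u₂ x) * ∑ i, dd (b i) (fun y => u₁ y - u₂ y) x ^ 2
      + sinh (u₁ x - u₂ x) * lap (fun y => u₁ y - u₂ y) x) := by
  have hw := h1.sub h2
  have e : AA u₁ u₂ = fun y => 2 * cosh (u₁ y - u₂ y) - 2 := rfl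
  rw [e, lap_sub ((Sm.const 2).mul (hw.comp (eventually_cosh _))) (Sm.const 2),
    lap_const_mul 2 (hw.comp (eventually_cosh _)), lap_const,
    lap_comp b (eventually_cosh _) hw, Real.deriv_cosh, Real.deriv_sinh]
  ring

theorem dd_gs (b : OrthonormalBasis (Fin 3) ℝ E3) (h : Sm f x) (v : E3) :
    dd v (gs f) x = ∑ i, 2 * (dd (b i) f x * dd v (dd (b i) f) x) := by
  have e : gs f = fun y => ∑ i, dd (b i) f y * dd (b i) f y := funext fun y => gs_eq b f y
  rw [e, dd_sum fun i _ => (h.dd _).mul (h.dd _)]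
  exact Finset.sum_congr rfl fun i _ => by rw [dd_mul (h.dd _) (h.dd _)]; ring

theorem lap_dd (h : Sm f x) (v : E3) : lap (dd v f) x = dd v (lap f) x := by
  let b := EuclideanSpace.basisFun (Fin 3) ℝ
  have e : lap f =ᶠ[𝓝 x] fun y => ∑ i, dd (b i) (dd (b i) f) y := by
    filter_upwards [h.nhds] with y hy using lap_eq b hy
  rw [dd_congr_at e, dd_sum fun i _ => (h.dd _).dd _, lap_eq b (h.dd v)]
  refine Finset.sum_congr rfl fun i _ => ?_
  rw [dd_comm (v := v) (h.dd _)]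
  exact dd_congr_at (dd_comm_eventually h)

theorem lap_gs (b : OrthonormalBasis (Fin 3) ℝ E3) (h : Sm f x) :
    lap (gs f) x = ∑ i, 2 * (dd (b i) f x * dd (b i) (lap f) x
      + ∑ j, dd (b j) (dd (b i) f) x ^ 2) := by
  have e : gs f = fun y => ∑ i, dd (b i) f y * dd (b i) f y := funext fun y => gs_eq b f y
  rw [e, lap_sum _ fun i _ => (h.dd _).mul (h.dd _)]
  refine Finset.sum_congr rfl fun i _ => ?_
  rw [lap_mul b (h.dd _) (h.dd _), lap_dd h]
  simp only [← sq]
  ring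

protected theorem Sm.lap (h : Sm f x) : Sm (lap f) x := by
  let b := EuclideanSpace.basisFun (Fin 3) ℝ
  have e : _root_.lap f =ᶠ[𝓝 x] fun y => ∑ i, MeanField.dd (b i) (MeanField.dd (b i) f) y := by
    filter_upwards [h.nhds] with y hy using lap_eq b hy
  exact (Sm.sum fun i _ => (h.dd _).dd _).congr e

theorem Sol.dd_lap_sub (h1 : Sol u₁) (h2 : Sol u₂) (hx : ‖x‖ = 1) (hv : ⟪x, v⟫ = 0) :
    dd v (lap fun y => u₁ y - u₂ y) x = -2 * exp (u₁ x + u₂ x) *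
      (sinh (u₁ x - u₂ x) * dd v (fun y => u₁ y + u₂ y) x
        + cosh (u₁ x - u₂ x) * dd v (fun y => u₁ y - u₂ y) x) := by
  have hx0 : x ≠ 0 := norm_ne_zero_iff.1 (by rw [hx]; exact one_ne_zero)
  have hw := (h1.sm hx0).sub (h2.sm hx0)
  have hm := (h1.sm hx0).add (h2.sm hx0)
  have e : (fun y => ‖y‖ ^ 2 * lap (fun z => u₁ z - u₂ z) y) =ᶠ[𝓝 x]
      fun y => -2 * (exp (u₁ y + u₂ y) * sinh (u₁ y - u₂ y)) := by
    filter_upwards [isOpen_ne.mem_nhds hx0] with y hy using h1.lap_sub_eq h2 hy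
  have e2 := dd_congr_at (v := v) e
  rw [dd_mul Sm.normSq hw.lap, dd_normSq, hv, hx,
    dd_const_mul _ ((hm.comp (eventually_exp _)).mul (hw.comp (eventually_sinh _))),
    dd_mul (hm.comp (eventually_exp _)) (hw.comp (eventually_sinh _)),
    dd_comp differentiable_exp.differentiableAt hm.differentiableAt,
    dd_comp differentiable_sinh.differentiableAt hw.differentiableAt,
    Real.deriv_exp, Real.deriv_sinh] at e2
  linarith

theorem dd_weight (hm : Sm f x) (v : E3) : dd v (fun y => ‖y‖ ^ 2 * exp (-f y)) x =
    ‖x‖ ^ 2 * (exp (-f x) * - dd v f x) + exp (-f x) * (2 * ⟪x, v⟫) := by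
  rw [dd_mul Sm.normSq (hm.neg.comp (eventually_exp _)), dd_normSq,
    dd_comp differentiable_exp.differentiableAt hm.neg.differentiableAt, Real.deriv_exp, dd_neg]

theorem lap_neg (hm : Sm f x) : lap (fun y => - f y) x = - lap f x := by
  have : (fun y => - f y) = fun y => (-1) * f y := funext fun y => by ring
  rw [this, lap_const_mul _ hm]; ring

theorem lap_weight (b : OrthonormalBasis (Fin 3) ℝ E3) (hm : Sm f x) :
    lap (fun y => ‖y‖ ^ 2 * exp (-f y)) x =
      ‖x‖ ^ 2 * (exp (-f x) * (∑ i, dd (b i) f x ^ 2 - lap f x))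
      + 2 * ∑ i, 2 * ⟪x, b i⟫ * (exp (-f x) * - dd (b i) f x) + exp (-f x) * 6 := by
  rw [lap_mul b Sm.normSq (hm.neg.comp (eventually_exp _)), lap_normSq,
    lap_comp b (eventually_exp _) hm.neg, lap_neg hm]
  simp only [dd_normSq, dd_neg, Real.deriv_exp, 
    dd_comp differentiable_exp.differentiableAt hm.neg.differentiableAt, neg_sq]
  ring

theorem weighted_identity_algebra {w0 w1 w00 w01 w11 m0 m1 E k s c : ℝ}
    (hEk : E * k = 1) (htr : w00 + w11 = -2 * (E * s)) (hc : 1 ≤ c) (hk : 0 < k)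
    {N0 N1 L S A N : ℝ} (hS : S = w0 * w0 + w1 * w1) (hA : A = 2 * c - 2) (hN : N = k * S + A)
    (hN0 : N0 = -m0 * k * S + k * (2 * (w0 * w00 + w1 * w01)) + 2 * s * w0)
    (hN1 : N1 = -m1 * k * S + k * (2 * (w0 * w01 + w1 * w11)) + 2 * s * w1)
    (hL : L = (k * (m0 ^ 2 + m1 ^ 2) + 2 * c) * S
      + 2 * (-m0 * k * (2 * (w0 * w00 + w1 * w01)) - m1 * k * (2 * (w0 * w01 + w1 * w11))
        - 4 * k * S)
      + k * (2 * (w0 * (-2 * E * (s * m0 + c * w0)) + w1 * (-2 * E * (s * m1 + c * w1)))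
        + 2 * (w00 ^ 2 + 2 * w01 ^ 2 + w11 ^ 2 + 2 * S))
      + 2 * (c * S + s * (-2 * (E * s)))) :
    0 ≤ N * L - (N0 ^ 2 + N1 ^ 2) + 4 * N ^ 2 - 4 * A * N := by
  obtain ⟨a, ha⟩ : ∃ a, a = (w00 - w11) / 2 - (w0 * m0 - w1 * m1) / 2 := ⟨_, rfl⟩
  obtain ⟨d, hd⟩ : ∃ d, d = w01 - (w0 * m1 + w1 * m0) / 2 := ⟨_, rfl⟩
  have hw11 : w11 = -2 * (E * s) - w00 := by linarith
  have e0 : N0 = 2 * k * (a * w0 + d * w1) := by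
    rw [hN0, ha, hd, hS, hw11]; linear_combination (-2 * s * w0) * hEk
  have e1 : N1 = 2 * k * (d * w0 - a * w1) := by
    rw [hN1, ha, hd, hS, hw11]; linear_combination (-2 * s * w1) * hEk
  have eL : L = 2 * k * (2 * (a ^ 2 + d ^ 2) - 2 * S) := by
    rw [hL, ha, hd, hS, hw11]
    linear_combination (4 * E * s ^ 2 - 4 * c * (w0 * w0 + w1 * w1)) * hEk
  have : N * L - (N0 ^ 2 + N1 ^ 2) + 4 * N ^ 2 - 4 * A * N
      = A * (2 * k * (2 * (a ^ 2 + d ^ 2))) := by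
    rw [e0, e1, eL, hN, hS]; ring
  rw [this]
  have : 0 ≤ A := by linarith
  positivity

theorem Sol.key (h1 : Sol u₁) (h2 : Sol u₂) (b : OrthonormalBasis (Fin 3) ℝ E3) (hb : b 2 = x) :
    0 ≤ NN u₁ u₂ x * lap (NN u₁ u₂) x - ∑ i, dd (b i) (NN u₁ u₂) x ^ 2
      + 4 * NN u₁ u₂ x ^ 2 - 4 * AA u₁ u₂ x * NN u₁ u₂ x := by
  have hx : ‖x‖ = 1 := by rw [← hb]; exact b.norm_eq_one 2
  have hx0 : x ≠ 0 := norm_ne_zero_iff.1 (by rw [hx]; exact one_ne_zero)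
  have s1 := h1.sm hx0
  have s2 := h2.sm hx0
  have hw := s1.sub s2
  have hm := s1.add s2
  have hW := Hom0.sub h1.hom h2.hom
  have hM := Hom0.add h1.hom h2.hom
  have i0 : ⟪x, b 0⟫ = 0 := by rw [← hb]; exact b.inner_eq_zero (by decide)
  have i1 : ⟪x, b 1⟫ = 0 := by rw [← hb]; exact b.inner_eq_zero (by decide)
  have i2 : ⟪x, b 2⟫ = 1 := by rw [← hb]; exact b.inner_eq_one 2
  have lw := h1.lap_sub_eq h2 hx0
  have lm := h1.lap_add_eq h2 hx0
  have d0 := h1.dd_lap_sub h2 hx i0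
  have d1 := h1.dd_lap_sub h2 hx i1
  have hfS : Sm (fun y => ‖y‖ ^ 2 * exp (-(u₁ y + u₂ y))) x :=
    Sm.normSq.mul (hm.neg.comp (eventually_exp _))
  have eN : NN u₁ u₂ = fun y => (‖y‖ ^ 2 * exp (-(u₁ y + u₂ y))) * gs (fun z => u₁ z - u₂ z) y
    + AA u₁ u₂ y := rfl
  have lN : lap (NN u₁ u₂) x = (‖x‖ ^ 2 * exp (-(u₁ x + u₂ x))) * lap (gs fun z => u₁ z - u₂ z) x
      + 2 * ∑ i, dd (b i) (fun y => ‖y‖ ^ 2 * exp (-(u₁ y + u₂ y))) x *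
        dd (b i) (gs fun z => u₁ z - u₂ z) x
      + gs (fun z => u₁ z - u₂ z) x * lap (fun y => ‖y‖ ^ 2 * exp (-(u₁ y + u₂ y))) x
      + lap (AA u₁ u₂) x := by
    rw [eN, lap_add (hfS.mul hw.gs) (s1.AA s2), lap_mul b hfS hw.gs]
  have gN : ∀ v, dd v (NN u₁ u₂) x =
      (‖x‖ ^ 2 * exp (-(u₁ x + u₂ x))) * dd v (gs fun z => u₁ z - u₂ z) x
      + gs (fun z => u₁ z - u₂ z) x * dd v (fun y => ‖y‖ ^ 2 * exp (-(u₁ y + u₂ y))) x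
      + dd v (AA u₁ u₂) x := fun v => by
    rw [eN, dd_add (hfS.mul hw.gs) (s1.AA s2), dd_mul hfS hw.gs]
  have w2 : dd (b 2) (fun y => u₁ y - u₂ y) x = 0 := by rw [hb]; exact Hom0.euler hW hw
  have m2 : dd (b 2) (fun y => u₁ y + u₂ y) x = 0 := by rw [hb]; exact Hom0.euler hM hm
  have w2j : ∀ v, dd (b 2) (dd v (fun y => u₁ y - u₂ y)) x = - dd v (fun y => u₁ y - u₂ y) x :=
    fun v => by rw [hb]; exact Hom0.euler_dd hW hw v
  have wj2 : ∀ v, dd v (dd (b 2) (fun y => u₁ y - u₂ y)) x = - dd v (fun y => u₁ y - u₂ y) x :=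
    fun v => by rw [dd_comm hw]; exact w2j v
  have w10 : dd (b 1) (dd (b 0) (fun y => u₁ y - u₂ y)) x =
    dd (b 0) (dd (b 1) (fun y => u₁ y - u₂ y)) x := dd_comm hw
  have gN2 : dd (b 2) (NN u₁ u₂) x = 0 := by
    rw [hb]; exact Hom0.euler (Hom0.NN h1.hom h2.hom) (s1.NN s2)
  have tr := lap_eq b hw
  rw [Fin.sum_univ_three, w2j, w2, neg_zero, add_zero] at tr
  simp only [hx, one_pow, one_mul] at lw lm
  rw [tr] at lw
  rw [Fin.sum_univ_three, gN2, gN, gN, lN, lap_AA b s1 s2, lap_gs b hw, lap_weight b hm, tr]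
  simp only [dd_gs b hw, dd_AA s1 s2, dd_weight hm, Fin.sum_univ_three, lm, i0, i1, i2, hx, d0, d1,
    w2, m2, w10, w2j, wj2]
  have hEk : exp (u₁ x + u₂ x) * exp (-(u₁ x + u₂ x)) = 1 := by rw [← exp_add]; simp
  have hN : NN u₁ u₂ x = exp (-(u₁ x + u₂ x)) * (dd (b 0) (fun y => u₁ y - u₂ y) x *
      dd (b 0) (fun y => u₁ y - u₂ y) x + dd (b 1) (fun y => u₁ y - u₂ y) x *
      dd (b 1) (fun y => u₁ y - u₂ y) x) + AA u₁ u₂ x := by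
    rw [eN]; simp only [gs_eq b, Fin.sum_univ_three, w2, hx]; ring
  have hgs : gs (fun y => u₁ y - u₂ y) x = dd (b 0) (fun y => u₁ y - u₂ y) x *
      dd (b 0) (fun y => u₁ y - u₂ y) x + dd (b 1) (fun y => u₁ y - u₂ y) x *
      dd (b 1) (fun y => u₁ y - u₂ y) x := by
    simp only [gs_eq b, Fin.sum_univ_three, w2]; ring
  rw [hgs]
  have key := weighted_identity_algebra hEk lw
    (one_le_cosh (u₁ x - u₂ x)) (exp_pos _)
    (m0 := dd (b 0) (fun y => u₁ y + u₂ y) x) (m1 := dd (b 1) (fun y => u₁ y + u₂ y) x)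
    (w0 := dd (b 0) (fun y => u₁ y - u₂ y) x) (w1 := dd (b 1) (fun y => u₁ y - u₂ y) x)
    (w01 := dd (b 0) (dd (b 1) (fun y => u₁ y - u₂ y)) x) rfl rfl hN rfl rfl rfl
  have hA : AA u₁ u₂ x = 2 * cosh (u₁ x - u₂ x) - 2 := rfl
  rw [hA]
  refine key.trans_eq ?_
  linear_combination (-(2 * NN u₁ u₂ x * cosh (u₁ x - u₂ x) *
    (dd (b 0) (fun y => u₁ y - u₂ y) x * dd (b 0) (fun y => u₁ y - u₂ y) x +
      dd (b 1) (fun y => u₁ y - u₂ y) x * dd (b 1) (fun y => u₁ y - u₂ y) x))) * hEk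
    - 2 * NN u₁ u₂ x * sinh (u₁ x - u₂ x) * lw

end pair

end

section

variable {f g : E3 → ℝ} {x v w : E3}

theorem exists_basis_last (hx : ‖x‖ = 1) : ∃ b : OrthonormalBasis (Fin 3) ℝ E3, b 2 = x := by
  have h : Orthonormal ℝ (({2} : Set (Fin 3)).domRestrict fun _ => x) := by
    refine ⟨fun _ => hx, fun i j hij => (hij (Subsingleton.elim _ _)).elim⟩
  obtain ⟨b, hb⟩ := h.exists_orthonormalBasis_extension_of_card_eq (by simp)
  exact ⟨b, hb 2 rfl⟩

theorem ne_zero_of_norm (hx : ‖x‖ = 1) : x ≠ 0 :=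
  norm_ne_zero_iff.1 (by rw [hx]; exact one_ne_zero)

/-! ### The functions `1 - ⟨x, q⟩` -/

/-- The `0`-homogeneous extension of `x ↦ 1 - ⟨x, q⟩`. -/
def DD (q y : E3) : ℝ := 1 - ⟪y, q⟫ * ‖y‖⁻¹

theorem Hom0.DD (q : E3) : Hom0 (DD q) := fun x r hr => by
  simp only [MeanField.DD, inner_smul_left, norm_smul, Real.norm_of_nonneg hr.le]
  rcases eq_or_ne ‖x‖ 0 with h | h
  · simp [h]
  · simp; field_simp

theorem Sm.norm (hx : x ≠ 0) : Sm (fun y => ‖y‖) x := by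
  filter_upwards [isOpen_ne.mem_nhds hx] with y hy using contDiffAt_norm ℝ hy

protected theorem Sm.DD (q : E3) (hx : x ≠ 0) : Sm (DD q) x := by
  refine (Sm.const 1).sub ((Sm.inner_left q).mul ?_)
  filter_upwards [isOpen_ne.mem_nhds hx] with y hy
  exact (contDiffAt_norm ℝ hy).inv (norm_ne_zero_iff.2 hy)

theorem DD_of_norm (q : E3) (hx : ‖x‖ = 1) : DD q x = 1 - ⟪x, q⟫ := by simp [DD, hx]

theorem DD_nonneg {q : E3} (hq : ‖q‖ = 1) (hx : ‖x‖ = 1) : 0 ≤ DD q x := by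
  have := real_inner_le_norm x q
  rw [DD_of_norm q hx]; rw [hq, hx] at this; linarith

theorem DD_le {q : E3} (hq : ‖q‖ = 1) (hx : ‖x‖ = 1) : DD q x ≤ 2 := by
  have := neg_le_of_abs_le (abs_real_inner_le_norm x q)
  rw [DD_of_norm q hx]; rw [hq, hx] at this; linarith

theorem dd_norm (hx : ‖x‖ = 1) (v : E3) : dd v (fun y => ‖y‖) x = ⟪x, v⟫ := by
  have h := Sm.norm (ne_zero_of_norm hx)
  have e : (fun y : E3 => ‖y‖ ^ 2) = fun y => ‖y‖ * ‖y‖ := funext fun y => sq _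
  have := dd_normSq (v := v) (x := x)
  rw [e, dd_mul h h, hx] at this
  linarith

theorem lap_norm (b : OrthonormalBasis (Fin 3) ℝ E3) (hb : b 2 = x) :
    lap (fun y => ‖y‖) x = 2 := by
  have hx : ‖x‖ = 1 := by rw [← hb]; exact b.norm_eq_one 2
  have h := Sm.norm (ne_zero_of_norm hx)
  have i0 : ⟪x, b 0⟫ = 0 := by rw [← hb]; exact b.inner_eq_zero (by decide)
  have i1 : ⟪x, b 1⟫ = 0 := by rw [← hb]; exact b.inner_eq_zero (by decide)
  have i2 : ⟪x, b 2⟫ = 1 := by rw [← hb]; exact b.inner_eq_one 2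
  have e : (fun y : E3 => ‖y‖ ^ 2) = fun y => ‖y‖ * ‖y‖ := funext fun y => sq _
  have := lap_normSq (x := x)
  rw [e, lap_mul b h h, hx, Fin.sum_univ_three, dd_norm hx, dd_norm hx, dd_norm hx, i0, i1, i2]
    at this
  linarith

theorem dd_lap_DD {q : E3} (hq : ‖q‖ = 1) (b : OrthonormalBasis (Fin 3) ℝ E3) (hb : b 2 = x) :
    ∑ i, dd (b i) (DD q) x ^ 2 = DD q x * (2 - DD q x) ∧ lap (DD q) x = 2 * (1 - DD q x) := by
  have hx : ‖x‖ = 1 := by rw [← hb]; exact b.norm_eq_one 2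
  have hx0 := ne_zero_of_norm hx
  have hn := Sm.norm hx0
  have hD := Sm.DD q hx0
  have i0 : ⟪x, b 0⟫ = 0 := by rw [← hb]; exact b.inner_eq_zero (by decide)
  have i1 : ⟪x, b 1⟫ = 0 := by rw [← hb]; exact b.inner_eq_zero (by decide)
  have e : (fun y => ‖y‖ * DD q y) =ᶠ[𝓝 x] fun y => ‖y‖ - ⟪y, q⟫ := by
    filter_upwards [isOpen_ne.mem_nhds hx0] with y hy
    have : ‖y‖ ≠ 0 := norm_ne_zero_iff.2 hy
    simp only [DD]; field_simp
  have h2 : dd (b 2) (DD q) x = 0 := by rw [hb]; exact Hom0.euler (Hom0.DD q) hD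
  have hv : ∀ v, dd v (DD q) x = ⟪x, v⟫ - ⟪v, q⟫ - DD q x * ⟪x, v⟫ := fun v => by
    have := dd_congr_at (v := v) e
    rw [dd_mul hn hD, dd_sub hn (Sm.inner_left q), dd_norm hx, dd_inner_left, hx] at this
    linarith
  have hL := lap_congr e
  rw [lap_mul b hn hD, lap_sub hn (Sm.inner_left q), lap_norm b hb, lap_inner_left, hx,
    Fin.sum_univ_three, h2, dd_norm hx, dd_norm hx, i0, i1] at hL
  have hs := b.sum_sq_norm_inner_right q
  rw [Fin.sum_univ_three, hb, hq] at hs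
  simp only [Real.norm_eq_abs, sq_abs] at hs
  refine ⟨?_, by linarith⟩
  rw [Fin.sum_univ_three, h2, hv, hv, i0, i1, DD_of_norm q hx]
  linear_combination hs

/-- The barrier profile. -/
def psi (γ t : ℝ) : ℝ := (γ - 1) * log t + γ * √t

theorem psi_smooth (γ : ℝ) {t : ℝ} (ht : 0 < t) : ∀ᶠ s in 𝓝 t, ContDiffAt ℝ ∞ (psi γ) s := by
  filter_upwards [eventually_gt_nhds ht] with s hs
  exact (contDiffAt_const.mul (contDiffAt_log.2 hs.ne')).add
    (contDiffAt_const.mul (contDiffAt_sqrt hs.ne'))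

theorem hasDerivAt_psi (γ : ℝ) {t : ℝ} (ht : 0 < t) :
    HasDerivAt (psi γ) ((γ - 1) * t⁻¹ + γ * (1 / (2 * √t))) t :=
  ((hasDerivAt_log ht.ne').const_mul _).add ((hasDerivAt_sqrt ht.ne').const_mul _)

theorem deriv_deriv_psi (γ : ℝ) {t : ℝ} (ht : 0 < t) :
    deriv (deriv (psi γ)) t = (1 - γ) / t ^ 2 - γ / (4 * (t * √t)) := by
  have e : deriv (psi γ) =ᶠ[𝓝 t] fun s => (γ - 1) * s⁻¹ + γ * (1 / (2 * √s)) := by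
    filter_upwards [eventually_gt_nhds ht] with s hs using (hasDerivAt_psi γ hs).deriv
  rw [e.deriv_eq]
  have hs : 0 < √t := sqrt_pos.2 ht
  have h1 := (((hasDerivAt_inv ht.ne').const_mul (γ - 1)).add
    ((((hasDerivAt_sqrt ht.ne').const_mul 2).inv (by positivity)).const_mul γ)).deriv
  simp only [one_div]
  refine Eq.trans ?_ (h1.trans ?_)
  · rfl
  · have : √t ^ 2 = t := sq_sqrt ht.le
    rw [← this]; simp only [sqrt_sq hs.le]
    field_simp; ring

theorem lap_psi_DD {q : E3} (hq : ‖q‖ = 1) (hx : ‖x‖ = 1) (γ : ℝ) (hD : 0 < DD q x) :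
    lap (fun y => psi γ (DD q y)) x = (1 - γ) + γ * (1 / (2 * √(DD q x)) - 3 / 4 * √(DD q x)) := by
  obtain ⟨b, hb⟩ := exists_basis_last hx
  obtain ⟨h1, h2⟩ := dd_lap_DD hq b hb
  rw [lap_comp b (psi_smooth γ hD) (Sm.DD q (ne_zero_of_norm hx)), h1, h2, deriv_deriv_psi γ hD,
    (hasDerivAt_psi γ hD).deriv]
  obtain ⟨s, hs, e⟩ : ∃ s, 0 < s ∧ DD q x = s ^ 2 :=
    ⟨√(DD q x), sqrt_pos.2 hD, (sq_sqrt hD.le).symm⟩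
  rw [e, sqrt_sq hs.le]
  field_simp; ring

section pair

variable {u₁ u₂ : E3 → ℝ}

theorem Sol.lap_log_NN (h1 : Sol u₁) (h2 : Sol u₂) (hx : ‖x‖ = 1) (hN : 0 < NN u₁ u₂ x) :
    -4 + 4 * AA u₁ u₂ x / NN u₁ u₂ x ≤ lap (fun y => log (NN u₁ u₂ y)) x := by
  obtain ⟨b, hb⟩ := exists_basis_last hx
  have hx0 := ne_zero_of_norm hx
  have key := h1.key h2 b hb
  have hl : ∀ᶠ t in 𝓝 (NN u₁ u₂ x), ContDiffAt ℝ ∞ log t := by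
    filter_upwards [eventually_gt_nhds hN] with t ht using contDiffAt_log.2 ht.ne'
  have e2 : deriv (deriv log) (NN u₁ u₂ x) = -(NN u₁ u₂ x ^ 2)⁻¹ := by
    rw [Real.deriv_log']; exact deriv_inv
  rw [lap_comp b hl ((h1.sm hx0).NN (h2.sm hx0)), e2, Real.deriv_log, ← sub_nonneg]
  have : -(NN u₁ u₂ x ^ 2)⁻¹ * ∑ i, dd (b i) (NN u₁ u₂) x ^ 2 + (NN u₁ u₂ x)⁻¹ * lap (NN u₁ u₂) x
      - (-4 + 4 * AA u₁ u₂ x / NN u₁ u₂ x) = (NN u₁ u₂ x * lap (NN u₁ u₂) x -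
      ∑ i, dd (b i) (NN u₁ u₂) x ^ 2 + 4 * NN u₁ u₂ x ^ 2 - 4 * AA u₁ u₂ x * NN u₁ u₂ x) /
        NN u₁ u₂ x ^ 2 := by
    field_simp; ring
  rw [this]
  positivity

theorem Sol.lap_AA_eq (h1 : Sol u₁) (h2 : Sol u₂) (hx : ‖x‖ = 1) :
    lap (AA u₁ u₂) x = 2 * (cosh (u₁ x - u₂ x) * exp (u₁ x + u₂ x)) * NN u₁ u₂ x
      - 2 * exp (u₁ x + u₂ x) * AA u₁ u₂ x * (2 * cosh (u₁ x - u₂ x) + 1) := by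
  obtain ⟨b, hb⟩ := exists_basis_last hx
  have hx0 := ne_zero_of_norm hx
  have lw := h1.lap_sub_eq h2 hx0
  rw [hx] at lw
  have hs := cosh_sq (u₁ x - u₂ x)
  have hEk : exp (u₁ x + u₂ x) * exp (-(u₁ x + u₂ x)) = 1 := by rw [← exp_add]; simp
  have hg : gs (fun y => u₁ y - u₂ y) x = ∑ i, dd (b i) (fun y => u₁ y - u₂ y) x ^ 2 := by
    simp only [gs_eq b, sq]
  rw [lap_AA b (h1.sm hx0) (h2.sm hx0), ← hg]
  simp only [NN, AA, hx]
  linear_combination 2 * sinh (u₁ x - u₂ x) * lw + 4 * exp (u₁ x + u₂ x) * hs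
    - 2 * cosh (u₁ x - u₂ x) * gs (fun y => u₁ y - u₂ y) x * hEk

theorem continuousOn_sphere_of_sm (h : ∀ x ≠ 0, Sm f x) : ContinuousOn f S2 := fun x hx =>
  (h x (ne_zero_of_norm (by simpa [S2] using hx))).differentiableAt.continuousAt.continuousWithinAt

theorem isCompact_S2 : IsCompact S2 := isCompact_sphere 0 1

theorem exists_upper_bound (h : ∀ x ≠ 0, Sm f x) : ∃ K > 0, ∀ x, ‖x‖ = 1 → f x ≤ K := by
  obtain ⟨K, hK⟩ := isCompact_S2.bddAbove_image (continuousOn_sphere_of_sm h)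
  refine ⟨max K 1, by positivity, fun x hx =>
    le_max_of_le_left (hK ⟨x, by simpa [S2] using hx, rfl⟩)⟩

theorem Sol.exists_lap_lower_bound (h1 : Sol u₁) (h2 : Sol u₂) : ∃ ε > 0, ∃ c > 0, ∀ x, ‖x‖ = 1 →
    0 < NN u₁ u₂ x → -4 + c * NN u₁ u₂ x ≤
      lap (fun y => log (NN u₁ u₂ y) + ε * AA u₁ u₂ y) x := by
  obtain ⟨K, hK0, hK⟩ := exists_upper_bound
    (f := fun x => NN u₁ u₂ x * (exp (u₁ x + u₂ x) * (2 * cosh (u₁ x - u₂ x) + 1)))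
    fun x hx => ((h1.sm hx).NN (h2.sm hx)).mul
      ((((h1.sm hx).add (h2.sm hx)).comp (eventually_exp _)).mul
        (((Sm.const 2).mul (((h1.sm hx).sub (h2.sm hx)).comp (eventually_cosh _))).add
          (Sm.const 1)))
  obtain ⟨k, hk0, hk⟩ := exists_upper_bound (f := fun x => exp (-(u₁ x + u₂ x)))
    fun x hx => ((h1.sm hx).add (h2.sm hx)).neg.comp (eventually_exp _)
  refine ⟨2 / K, by positivity, 2 * (2 / K) * k⁻¹, by positivity, fun x hx hN => ?_⟩
  have hx0 := ne_zero_of_norm hx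
  have sN := (h1.sm hx0).NN (h2.sm hx0)
  have sA := (h1.sm hx0).AA (h2.sm hx0)
  have sl : Sm (fun y => log (NN u₁ u₂ y)) x := by
    refine sN.comp ?_
    filter_upwards [eventually_gt_nhds hN] with t ht using contDiffAt_log.2 ht.ne'
  rw [lap_add sl ((Sm.const _).mul sA), lap_const_mul _ sA, h1.lap_AA_eq h2 hx]
  have hl := h1.lap_log_NN h2 hx hN
  have hKx := hK x hx
  have hkx := hk x hx
  have hA := AA_nonneg u₁ u₂ x
  have hc := one_le_cosh (u₁ x - u₂ x)
  have hE := exp_pos (u₁ x + u₂ x)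
  have hE' : k⁻¹ ≤ exp (u₁ x + u₂ x) := by
    rw [exp_neg] at hkx
    exact inv_le_of_inv_le₀ hE hkx
  have a1 : 2 / K * (2 * exp (u₁ x + u₂ x) * AA u₁ u₂ x * (2 * cosh (u₁ x - u₂ x) + 1))
      ≤ 4 * AA u₁ u₂ x / NN u₁ u₂ x := by
    rw [div_mul_eq_mul_div, div_le_div_iff₀ hK0 hN]
    have := mul_le_mul_of_nonneg_left hKx (mul_nonneg zero_le_four hA)
    calc _ = 4 * AA u₁ u₂ x * (NN u₁ u₂ x * (exp (u₁ x + u₂ x) *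
          (2 * cosh (u₁ x - u₂ x) + 1))) := by ring
      _ ≤ _ := this
  have a2 : 2 * (2 / K) * k⁻¹ * NN u₁ u₂ x ≤
      2 / K * (2 * (cosh (u₁ x - u₂ x) * exp (u₁ x + u₂ x)) * NN u₁ u₂ x) := by
    have : k⁻¹ ≤ cosh (u₁ x - u₂ x) * exp (u₁ x + u₂ x) := by nlinarith
    have h3 : 0 ≤ 2 * (2 / K) * NN u₁ u₂ x := by positivity
    have := mul_le_mul_of_nonneg_left this h3
    linarith
  rw [mul_sub]
  linarith

end pair

end

section

variable {f g : E3 → ℝ} {x v w : E3} {u₁ u₂ : E3 → ℝ}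

/-- A `0`-homogeneous function whose restriction to the sphere has a local maximum has a local
maximum in space. -/
theorem isLocalMax_of_sphere (hf : Hom0 f) (hx : ‖x‖ = 1)
    (h : ∀ᶠ y in 𝓝 x, ‖y‖ = 1 → f y ≤ f x) : IsLocalMax f x := by
  have hx0 := ne_zero_of_norm hx
  have hc : Tendsto (fun y : E3 => ‖y‖⁻¹ • y) (𝓝 x) (𝓝 x) := by
    have : ContinuousAt (fun y : E3 => ‖y‖⁻¹ • y) x :=
      (continuousAt_id.norm.inv₀ (norm_ne_zero_iff.2 hx0)).smul continuousAt_id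
    simpa [ContinuousAt, hx] using this
  filter_upwards [hc.eventually h, isOpen_ne.mem_nhds hx0] with y hy hy0
  have hn : 0 < ‖y‖ := norm_pos_iff.2 hy0
  rw [hf y _ (inv_pos.2 hn)] at hy
  exact hy (by simp [norm_smul, hn.ne'])

/-- The auxiliary function of the maximum principle argument. -/
def barrier (u₁ u₂ : E3 → ℝ) (q : Fin 4 → E3) (ε γ : ℝ) (y : E3) : ℝ :=
  (log (NN u₁ u₂ y) + ε * AA u₁ u₂ y) + ∑ j, psi γ (DD (q j) y)

section barrier

variable {q : Fin 4 → E3} {ε γ : ℝ}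

theorem barrier_hom (h1 : Hom0 u₁) (h2 : Hom0 u₂) : Hom0 (barrier u₁ u₂ q ε γ) := fun x r hr => by
  simp only [barrier, Hom0.NN h1 h2 x r hr, Hom0.AA h1 h2 x r hr, (Hom0.DD _) x r hr]

theorem sm_log_NN (h1 : Sol u₁) (h2 : Sol u₂) (hx : x ≠ 0) (hN : 0 < NN u₁ u₂ x) :
    Sm (fun y => log (NN u₁ u₂ y)) x := by
  refine ((h1.sm hx).NN (h2.sm hx)).comp ?_
  filter_upwards [eventually_gt_nhds hN] with t ht using contDiffAt_log.2 ht.ne'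

theorem barrier_sm (h1 : Sol u₁) (h2 : Sol u₂) (hx : x ≠ 0) (hN : 0 < NN u₁ u₂ x)
    (hD : ∀ j, 0 < DD (q j) x) : Sm (barrier u₁ u₂ q ε γ) x :=
  ((sm_log_NN h1 h2 hx hN).add ((Sm.const _).mul ((h1.sm hx).AA (h2.sm hx)))).add
    (Sm.sum fun j _ => (Sm.DD _ hx).comp (psi_smooth γ (hD j)))

theorem barrier_lap {c : ℝ} (h1 : Sol u₁) (h2 : Sol u₂) (hq : ∀ j, ‖q j‖ = 1) (hx : ‖x‖ = 1)
    (hN : 0 < NN u₁ u₂ x) (hD : ∀ j, 0 < DD (q j) x) (hγ : 0 ≤ γ)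
    (hc : -4 + c * NN u₁ u₂ x ≤ lap (fun y => log (NN u₁ u₂ y) + ε * AA u₁ u₂ y) x) :
    c * NN u₁ u₂ x + γ * (∑ j, 1 / (2 * √(DD (q j) x)) - 9) ≤
      lap (barrier u₁ u₂ q ε γ) x := by
  have hx0 := ne_zero_of_norm hx
  have e : barrier u₁ u₂ q ε γ = fun y => (log (NN u₁ u₂ y) + ε * AA u₁ u₂ y) +
    ∑ j, psi γ (DD (q j) y) := rfl
  rw [e, lap_add ((sm_log_NN h1 h2 hx0 hN).add ((Sm.const _).mul ((h1.sm hx0).AA (h2.sm hx0))))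
    (Sm.sum fun j _ => (Sm.DD _ hx0).comp (psi_smooth γ (hD j))),
    lap_sum _ fun j _ => (Sm.DD _ hx0).comp (psi_smooth γ (hD j))]
  simp only [lap_psi_DD (hq _) hx γ (hD _)]
  have hs : ∀ j, √(DD (q j) x) ≤ 3 / 2 := fun j => by
    rw [sqrt_le_left (by norm_num)]; have := DD_le (hq j) hx; linarith
  have h0 := hs 0
  have h1 := hs 1
  have h2 := hs 2
  have h3 := hs 3
  simp only [Fin.sum_univ_four]
  have : 0 ≤ γ * (6 - (√(DD (q 0) x) + √(DD (q 1) x) + √(DD (q 2) x) + √(DD (q 3) x))) :=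
    mul_nonneg hγ (by linarith)
  nlinarith

/-- If the comparison quantity is dominated by a product of four factors `1 - ⟨x, q⟩`, then it
vanishes identically. -/
theorem Sol.NN_eq_zero_of_le (h1 : Sol u₁) (h2 : Sol u₂) (hq : ∀ j, ‖q j‖ = 1) {C : ℝ}
    (hC : ∀ x, ‖x‖ = 1 → NN u₁ u₂ x ≤ C * ∏ j, DD (q j) x) (hx : ‖x‖ = 1) : NN u₁ u₂ x = 0 := by
  by_contra hne
  have hN0 : 0 < NN u₁ u₂ x := lt_of_le_of_ne (NN_nonneg _ _ _) (Ne.symm hne)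
  have hprod : ∀ y, ‖y‖ = 1 → 0 ≤ ∏ j, DD (q j) y := fun y hy =>
    Finset.prod_nonneg fun j _ => DD_nonneg (hq j) hy
  have hC0 : 0 < C := by
    by_contra! hC'
    linarith [hC x hx, mul_nonpos_of_nonpos_of_nonneg hC' (hprod x hx)]
  have hDpos : ∀ y, ‖y‖ = 1 → 0 < NN u₁ u₂ y → ∀ j, 0 < DD (q j) y := fun y hy hN j => by
    refine lt_of_le_of_ne (DD_nonneg (hq j) hy) fun h => ?_
    have := hC y hy
    rw [Finset.prod_eq_zero (Finset.mem_univ j) h.symm] at this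
    linarith
  obtain ⟨ε, hε, c, hc, hlap⟩ := h1.exists_lap_lower_bound h2
  obtain ⟨a, ha, hA⟩ := exists_upper_bound (f := AA u₁ u₂) fun x hx => (h1.sm hx).AA (h2.sm hx)
  have hsq : ∀ y, ‖y‖ = 1 → ∀ j, √(DD (q j) y) ≤ 2 := fun y hy j => by
    rw [sqrt_le_left (by norm_num)]; have := DD_le (hq j) hy; linarith
  have hlogD : ∀ y, ‖y‖ = 1 → ∀ j, 0 < DD (q j) y → log (DD (q j) y) ≤ 1 := fun y hy j h => by
    linarith [log_le_sub_one_of_pos h, DD_le (hq j) hy]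
  -- lower bound for the barrier at `x`, uniform in `γ`
  obtain ⟨L, hL⟩ : ∃ L : ℝ, ∀ γ, 0 ≤ γ → γ ≤ 1 → L ≤ barrier u₁ u₂ q ε γ x := by
    refine ⟨log (NN u₁ u₂ x) + ε * AA u₁ u₂ x - ∑ j, |log (DD (q j) x)|, fun γ h0 h1 => ?_⟩
    have : ∀ j, -|log (DD (q j) x)| ≤ psi γ (DD (q j) x) := fun j => by
      have a1 : (γ - 1) * log (DD (q j) x) ≥ -|log (DD (q j) x)| := by
        have := neg_abs_le ((γ - 1) * log (DD (q j) x))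
        rw [abs_mul] at this
        have h4 : |γ - 1| ≤ 1 := by rw [abs_le]; constructor <;> linarith
        nlinarith [abs_nonneg (log (DD (q j) x))]
      have a2 : 0 ≤ γ * √(DD (q j) x) := by positivity
      simp only [psi]; linarith
    have := Finset.sum_le_sum fun j (_ : j ∈ Finset.univ) => this j
    rw [Finset.sum_neg_distrib] at this
    simp only [barrier]; linarith
  set B : ℝ := ε * a + 4 * log 324 + 8 with hB
  obtain ⟨γ, hγ0, hγ1, hγ⟩ : ∃ γ : ℝ, 0 < γ ∧ γ ≤ 1 ∧ 9 * γ / c < exp (L - B) := by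
    refine ⟨min 1 (c / 18 * exp (L - B)), by positivity, min_le_left _ _, ?_⟩
    have h5 := min_le_right 1 (c / 18 * exp (L - B))
    have h6 := exp_pos (L - B)
    rw [div_lt_iff₀ hc]
    nlinarith [mul_pos hc h6]
  have hLx := hL γ hγ0.le hγ1
  set F := barrier u₁ u₂ q ε γ with hF
  -- coercivity
  obtain ⟨η, hη0, hη⟩ : ∃ η > 0, ∀ y, ‖y‖ = 1 → 0 < NN u₁ u₂ y → L ≤ F y →
      ∀ j, η ≤ DD (q j) y := by
    refine ⟨exp ((L - (log C + ε * a + 8)) / γ - 3), exp_pos _, fun y hy hN hLy j => ?_⟩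
    have hD := hDpos y hy hN
    have e1 : log (NN u₁ u₂ y) ≤ log C + ∑ j, log (DD (q j) y) := by
      rw [← log_prod fun j _ => (hD j).ne', ← log_mul hC0.ne' (Finset.prod_pos fun j _ => hD j).ne']
      exact log_le_log hN (hC y hy)
    have e2 : ε * AA u₁ u₂ y ≤ ε * a := mul_le_mul_of_nonneg_left (hA y hy) hε.le
    have e3 : F y = log (NN u₁ u₂ y) + ε * AA u₁ u₂ y + ((γ - 1) * ∑ j, log (DD (q j) y) +
        γ * ∑ j, √(DD (q j) y)) := by
      simp only [hF, barrier, psi, Finset.sum_add_distrib, Finset.mul_sum]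
    have e4 : ∑ j, √(DD (q j) y) ≤ 8 := by
      have := Finset.sum_le_sum fun j (_ : j ∈ Finset.univ) => hsq y hy j
      simp at this; linarith
    have e4' : 0 ≤ ∑ j, √(DD (q j) y) := Finset.sum_nonneg fun j _ => sqrt_nonneg _
    have e5 : ∑ j, log (DD (q j) y) ≤ log (DD (q j) y) + 3 := by
      have := Finset.sum_le_sum fun i (_ : i ∈ Finset.univ.erase j) => hlogD y hy i (hD i)
      simp at this; linarith
    rw [← log_le_log_iff (exp_pos _) (hD j), log_exp]
    have e6 : L - (log C + ε * a + 8) ≤ γ * ∑ j, log (DD (q j) y) := by nlinarith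
    have e7 : (L - (log C + ε * a + 8)) / γ ≤ ∑ j, log (DD (q j) y) := by
      rw [div_le_iff₀ hγ0]; linarith
    linarith
  obtain ⟨δ, hδ0, hδ⟩ : ∃ δ > 0, ∀ y, ‖y‖ = 1 → 0 < NN u₁ u₂ y → L ≤ F y → δ ≤ NN u₁ u₂ y := by
    refine ⟨exp (L - ε * a - ∑ j : Fin 4, (|log η| + 3)), exp_pos _, fun y hy hN hLy => ?_⟩
    have hD := hDpos y hy hN
    have e2 : ε * AA u₁ u₂ y ≤ ε * a := mul_le_mul_of_nonneg_left (hA y hy) hε.le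
    have e3 : ∀ j, psi γ (DD (q j) y) ≤ |log η| + 3 := fun j => by
      have b1 : log η ≤ log (DD (q j) y) := log_le_log hη0 (hη y hy hN hLy j)
      have b2 := hlogD y hy j (hD j)
      have b3 := hsq y hy j
      have b4 : 0 ≤ √(DD (q j) y) := sqrt_nonneg _
      have b5 := neg_abs_le (log η)
      have b6 := abs_nonneg (log η)
      simp only [psi]
      nlinarith
    have := Finset.sum_le_sum fun j (_ : j ∈ Finset.univ) => e3 j
    rw [← log_le_log_iff (exp_pos _) hN, log_exp]
    simp only [hF, barrier] at hLy
    linarith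
  -- the maximum point
  let T : Set E3 := {y ∈ S2 | δ ≤ NN u₁ u₂ y ∧ ∀ j, η ≤ DD (q j) y}
  have cN : ContinuousOn (NN u₁ u₂) S2 := continuousOn_sphere_of_sm fun x hx =>
    (h1.sm hx).NN (h2.sm hx)
  have cD : ∀ j, ContinuousOn (DD (q j)) S2 := fun j => continuousOn_sphere_of_sm fun x hx =>
    Sm.DD _ hx
  have hTc : IsCompact T := by
    refine isCompact_S2.of_isClosed_subset ?_ fun y hy => hy.1
    have e : T = (S2 ∩ NN u₁ u₂ ⁻¹' Set.Ici δ) ∩ ⋂ j, (S2 ∩ DD (q j) ⁻¹' Set.Ici η) := by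
      ext y
      simp only [T, Set.mem_sep_iff, Set.mem_inter_iff, Set.mem_preimage, Set.mem_Ici,
        Set.mem_iInter]
      constructor
      · rintro ⟨a, b, c⟩; exact ⟨⟨a, b⟩, fun j => ⟨a, c j⟩⟩
      · rintro ⟨⟨a, b⟩, c⟩; exact ⟨a, b, fun j => (c j).2⟩
    rw [e]
    exact (cN.preimage_isClosed_of_isClosed isCompact_S2.isClosed isClosed_Ici).inter
      (isClosed_iInter fun j =>
        (cD j).preimage_isClosed_of_isClosed isCompact_S2.isClosed isClosed_Ici)
  have hS : ∀ {y : E3}, y ∈ S2 ↔ ‖y‖ = 1 := fun {y} => by simp [S2]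
  have hFc : ContinuousOn F T := fun y hy =>
    (barrier_sm h1 h2 (ne_zero_of_norm (hS.1 hy.1)) (hδ0.trans_le hy.2.1)
      fun j => hη0.trans_le (hy.2.2 j)).differentiableAt.continuousAt.continuousWithinAt
  have hxT : x ∈ T := ⟨hS.2 hx, hδ x hx hN0 hLx, hη x hx hN0 hLx⟩
  obtain ⟨z, hzT, hz⟩ := hTc.exists_isMaxOn ⟨x, hxT⟩ hFc
  have hLz : L ≤ F z := hLx.trans (hz hxT)
  have hz1 : ‖z‖ = 1 := hS.1 hzT.1
  have hz0 := ne_zero_of_norm hz1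
  have hNz : 0 < NN u₁ u₂ z := hδ0.trans_le hzT.2.1
  have hDz := hDpos z hz1 hNz
  have hmax : IsLocalMax F z := by
    refine isLocalMax_of_sphere (barrier_hom h1.hom h2.hom) hz1 ?_
    have := ((h1.sm hz0).NN (h2.sm hz0)).differentiableAt.continuousAt.eventually
      (eventually_gt_nhds hNz)
    filter_upwards [this] with y hy hy1
    rcases le_or_gt L (F y) with h | h
    · exact hz ⟨hS.2 hy1, hδ y hy1 hy h, hη y hy1 hy h⟩
    · exact h.le.trans hLz
  have hsm : Sm F z := barrier_sm h1 h2 hz0 hNz hDz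
  have hle := (barrier_lap (ε := ε) h1 h2 hq hz1 hNz hDz hγ0.le (hlap z hz1 hNz)).trans
    (lap_nonpos_of_isLocalMax hsm hmax)
  have hpos : ∀ j, 0 ≤ 1 / (2 * √(DD (q j) z)) := fun j => by positivity
  have hsum := Finset.sum_nonneg fun j (_ : j ∈ Finset.univ) => hpos j
  have hcN : 0 < c * NN u₁ u₂ z := mul_pos hc hNz
  have hNle : NN u₁ u₂ z ≤ 9 * γ / c := by
    rw [le_div_iff₀ hc]; nlinarith
  have hDle : ∀ j, log (DD (q j) z) ≥ - log 324 := fun j => by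
    have h9 : ∑ j, 1 / (2 * √(DD (q j) z)) ≤ 9 := by nlinarith
    have h10 := (Finset.single_le_sum (fun j _ => hpos j) (Finset.mem_univ j)).trans h9
    have hs : 0 < √(DD (q j) z) := sqrt_pos.2 (hDz j)
    rw [div_le_iff₀ (by positivity)] at h10
    have h11 : (1 / 18) ^ 2 ≤ √(DD (q j) z) ^ 2 := pow_le_pow_left₀ (by norm_num) (by linarith) 2
    rw [sq_sqrt (hDz j).le] at h11
    rw [← log_inv, ge_iff_le]
    exact log_le_log (by norm_num) (by norm_num at h11 ⊢; linarith)
  have hpsi : ∀ j, psi γ (DD (q j) z) ≤ log 324 + 2 := fun j => by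
    have b1 := hDle j
    have b3 := hsq z hz1 j
    have b4 : 0 ≤ √(DD (q j) z) := sqrt_nonneg _
    have b5 : 0 ≤ log (324 : ℝ) := log_nonneg (by norm_num)
    simp only [psi]
    nlinarith
  have hps := Finset.sum_le_sum fun j (_ : j ∈ Finset.univ) => hpsi j
  have e2 : ε * AA u₁ u₂ z ≤ ε * a := mul_le_mul_of_nonneg_left (hA z hz1) hε.le
  have hlogN : log (NN u₁ u₂ z) < L - B := by
    rw [log_lt_iff_lt_exp hNz]; exact hNle.trans_lt hγ
  simp only [hF, barrier] at hLz
  simp only [Finset.sum_const, Finset.card_univ, Fintype.card_fin, nsmul_eq_mul] at hps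
  push_cast at hps
  linarith

end barrier

end

section

variable {f g : E3 → ℝ} {x p v w : E3} {u₁ u₂ : E3 → ℝ} {k n : ℕ}

/-! ### Order of vanishing -/

/-- All derivatives of `f` of order less than `k` vanish at `p`. -/
def Van : ℕ → (E3 → ℝ) → E3 → Prop
  | 0, _, _ => True
  | k + 1, f, p => f p = 0 ∧ ∀ v, Van k (dd v f) p

theorem Van.congr (h : f =ᶠ[𝓝 p] g) (hg : Van k g p) : Van k f p := by
  induction k generalizing f g with
  | zero => trivial
  | succ k ih => exact ⟨h.self_of_nhds.trans hg.1, fun v => ih (dd_congr h) (hg.2 v)⟩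

theorem Van.of_le (hf : Van n f p) (hk : k ≤ n) : Van k f p := by
  induction k generalizing f n with
  | zero => trivial
  | succ k ih =>
    obtain ⟨n, rfl⟩ := Nat.exists_eq_add_of_le' (Nat.one_le_iff_ne_zero.2 (by omega : n ≠ 0))
    exact ⟨hf.1, fun v => ih (hf.2 v) (by omega)⟩

theorem Van.add (sf : Sm f p) (sg : Sm g p) (hf : Van k f p) (hg : Van k g p) :
    Van k (fun y => f y + g y) p := by
  induction k generalizing f g with
  | zero => trivial
  | succ k ih =>
    refine ⟨by simp [hf.1, hg.1], fun v => ?_⟩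
    refine (ih (sf.dd v) (sg.dd v) (hf.2 v) (hg.2 v)).congr ?_
    filter_upwards [sf.nhds, sg.nhds] with y h1 h2 using dd_add h1 h2

theorem Van.zero : Van k (fun _ => 0) p := by
  induction k with
  | zero => trivial
  | succ k ih => exact ⟨rfl, fun v => ih.congr (Eventually.of_forall fun y => dd_const 0)⟩

theorem Van.sum {ι : Type*} {s : Finset ι} {F : ι → E3 → ℝ} (hs : ∀ i ∈ s, Sm (F i) p)
    (h : ∀ i ∈ s, Van k (F i) p) : Van k (fun y => ∑ i ∈ s, F i y) p := by
  classical
  induction s using Finset.induction_on with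
  | empty => simpa using Van.zero
  | insert a s ha ih =>
    simp only [Finset.sum_insert ha]
    exact (h a (by simp)).add (hs a (by simp)) (Sm.sum fun i hi => hs i (by simp [hi]))
      (ih (fun i hi => hs i (by simp [hi])) fun i hi => h i (by simp [hi]))

theorem Van.mul {i j : ℕ} (sf : Sm f p) (sg : Sm g p) (hf : Van i f p) (hg : Van j g p)
    (hk : k ≤ i + j) : Van k (fun y => f y * g y) p := by
  induction k generalizing f g i j with
  | zero => trivial
  | succ k ih =>
    constructor
    · rcases Nat.eq_zero_or_pos i with h0 | h0
      · simp [(hg.of_le (by omega : 1 ≤ j)).1]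
      · simp [(hf.of_le (by omega : 1 ≤ i)).1]
    · intro v
      have hf' : Van (i - 1) (dd v f) p := by
        cases i with
        | zero => trivial
        | succ i => exact hf.2 v
      have hg' : Van (j - 1) (dd v g) p := by
        cases j with
        | zero => trivial
        | succ j => exact hg.2 v
      refine ((ih sf (sg.dd v) hf hg' (by omega)).add (sf.mul (sg.dd v)) (sg.mul (sf.dd v))
        (ih sg (sf.dd v) hg hf' (by omega))).congr ?_
      filter_upwards [sf.nhds, sg.nhds] with y h1 h2 using dd_mul h1 h2

theorem Van.neg (sf : Sm f p) (hf : Van k f p) : Van k (fun y => -f y) p := by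
  have : Van k (fun y => (fun _ => (-1 : ℝ)) y * f y) p :=
    Van.mul (i := 0) (Sm.const _) sf trivial hf (by omega)
  simpa using this

theorem Van.sub (sf : Sm f p) (sg : Sm g p) (hf : Van k f p) (hg : Van k g p) :
    Van k (fun y => f y - g y) p := by
  simpa only [sub_eq_add_neg] using hf.add sf sg.neg (hg.neg sg)

theorem Van.sinh (sf : Sm f p) (hf : Van k f p) : Van k (fun y => sinh (f y)) p := by
  cases k with
  | zero => trivial
  | succ k =>
    refine ⟨by simp [hf.1], fun v => ?_⟩
    have : Van k (fun y => cosh (f y) * dd v f y) p :=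
      Van.mul (i := 0) (Sm.comp (eventually_cosh _) sf) (sf.dd v) trivial (hf.2 v) (by omega)
    refine this.congr ?_
    filter_upwards [sf.nhds] with y h1
    rw [dd_comp differentiable_sinh.differentiableAt h1.differentiableAt, Real.deriv_sinh]

theorem Van.of_basis (b : OrthonormalBasis (Fin 3) ℝ E3) (sf : Sm f p) (h0 : f p = 0)
    (h : ∀ i, Van k (dd (b i) f) p) : Van (k + 1) f p := by
  refine ⟨h0, fun v => ?_⟩
  have : Van k (fun y => ∑ i, (fun _ => ⟪b i, v⟫) y * dd (b i) f y) p :=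
    Van.sum (fun i _ => (Sm.const _).mul (sf.dd _)) fun i _ =>
      Van.mul (i := 0) (Sm.const _) (sf.dd _) trivial (h i) (by omega)
  exact this.congr (Eventually.of_forall fun y => dd_basis b f v y)

theorem norm_fderiv_le_sum (b : OrthonormalBasis (Fin 3) ℝ E3) (f : E3 → ℝ) (x : E3) :
    ‖fderiv ℝ f x‖ ≤ ∑ i, ‖dd (b i) f x‖ := by
  refine ContinuousLinearMap.opNorm_le_bound _ (Finset.sum_nonneg fun i _ => norm_nonneg _)
    fun v => ?_
  change ‖dd v f x‖ ≤ _
  rw [dd_basis b f v x, Finset.sum_mul]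
  refine (norm_sum_le _ _).trans (Finset.sum_le_sum fun i _ => ?_)
  rw [norm_mul, mul_comm]
  gcongr
  simpa using norm_inner_le_norm (𝕜 := ℝ) (b i) v

theorem Van.isBigO (sf : Sm f p) (hf : Van k f p) : f =O[𝓝 p] fun x => ‖x - p‖ ^ k := by
  induction k generalizing f with
  | zero =>
    simpa using sf.differentiableAt.continuousAt.isBigO_one ℝ
  | succ k ih =>
    have b := EuclideanSpace.basisFun (Fin 3) ℝ
    have h1 : (fun x => ∑ i, ‖dd (b i) f x‖) =O[𝓝 p] fun x => ‖x - p‖ ^ k := by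
      refine (Asymptotics.IsBigO.sum (s := Finset.univ) (A := fun i x => ‖dd (b i) f x‖)
        fun i _ => (ih (sf.dd (b i)) (hf.2 _)).norm_left).congr_left fun x => by simp
    obtain ⟨C, hC0, hC⟩ := h1.exists_pos
    have h2 := hC.bound.and sf
    obtain ⟨r, hr, hball⟩ := Metric.eventually_nhds_iff_ball.1 h2
    refine Asymptotics.IsBigO.of_bound C ?_
    filter_upwards [Metric.ball_mem_nhds p hr] with x hx
    have hsub : Metric.closedBall p ‖x - p‖ ⊆ Metric.ball p r :=
      Metric.closedBall_subset_ball (by simpa [dist_eq_norm] using hx)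
    have := (convex_closedBall p ‖x - p‖).norm_image_sub_le_of_norm_fderiv_le (f := f) (𝕜 := ℝ)
      (C := C * ‖x - p‖ ^ k) (x := p) (y := x)
      (fun y hy => (hball y (hsub hy)).2.differentiableAt (by simp)) (fun y hy => ?_)
      (by simp) (by simp [dist_eq_norm])
    · rw [hf.1, sub_zero] at this
      rw [pow_succ, norm_mul]
      simpa [mul_assoc] using this
    · refine (norm_fderiv_le_sum b f y).trans ?_
      have h3 := (hball y (hsub hy)).1
      rw [Real.norm_of_nonneg (Finset.sum_nonneg fun i _ => norm_nonneg _)] at h3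
      refine h3.trans ?_
      have h4 : ‖y - p‖ ≤ ‖x - p‖ := by simpa [dist_eq_norm] using hy
      simp only [norm_pow, norm_norm]
      gcongr

theorem iterate_dd_congr (h : f =ᶠ[𝓝 p] g) (n : ℕ) : (dd v)^[n] f =ᶠ[𝓝 p] (dd v)^[n] g := by
  induction n generalizing f g with
  | zero => exact h
  | succ n ih => exact ih (dd_congr h)

theorem iterate_dd_sub (sf : Sm f p) (sg : Sm g p) (n : ℕ) :
    (dd v)^[n] (fun y => f y - g y) p = (dd v)^[n] f p - (dd v)^[n] g p := by
  induction n generalizing f g with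
  | zero => rfl
  | succ n ih =>
    refine Eq.trans (iterate_dd_congr (g := fun y => dd v f y - dd v g y) ?_ n).self_of_nhds
      (ih (sf.dd v) (sg.dd v))
    filter_upwards [sf.nhds, sg.nhds] with y h1 h2 using dd_sub h1 h2

theorem Van.iterate_dd_eq_zero (h : Van (n + 1) f p) : (dd v)^[n] f p = 0 := by
  induction n generalizing f with
  | zero => exact h.1
  | succ n ih => exact ih (h.2 v)

/-- The leading homogeneous part of a function vanishing to order `n + 1` is a planar harmonic
polynomial, as soon as the transversal derivative and the planar Laplacian vanish to suitable
order; such a polynomial is determined by two coefficients. -/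
theorem Van.succ_of_harmonic (b : OrthonormalBasis (Fin 3) ℝ E3) (sf : Sm f p)
    (hf : Van (n + 1) f p) (h2 : Van (n + 1) (dd (b 2) f) p)
    (hl : Van n (fun y => dd (b 0) (dd (b 0) f) y + dd (b 1) (dd (b 1) f) y) p)
    (h00 : (dd (b 0))^[n + 1] f p = 0) (h01 : (dd (b 0))^[n] (dd (b 1) f) p = 0) :
    Van (n + 2) f p := by
  induction n generalizing f with
  | zero =>
    refine Van.of_basis b sf hf.1 fun i => ?_
    fin_cases i
    · exact ⟨h00, fun _ => trivial⟩
    · exact ⟨h01, fun _ => trivial⟩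
    · exact h2
  | succ n ih =>
    have hl' : ∀ i, Van n (fun y => dd (b 0) (dd (b 0) (dd (b i) f)) y +
        dd (b 1) (dd (b 1) (dd (b i) f)) y) p := fun i => by
      refine (hl.2 (b i)).congr ?_
      filter_upwards [sf.nhds] with y hy
      rw [dd_add ((hy.dd _).dd _) ((hy.dd _).dd _), dd_comm (v := b i) (hy.dd (b 0)),
        dd_comm (v := b i) (hy.dd (b 1)),
        dd_congr_at (dd_comm_eventually (v := b i) (w := b 0) hy),
        dd_congr_at (dd_comm_eventually (v := b i) (w := b 1) hy)]
    refine Van.of_basis b sf hf.1 fun i => ?_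
    have hp : Van (n + 1) (dd (b 2) (dd (b i) f)) p :=
      (h2.2 (b i)).congr (dd_comm_eventually sf)
    fin_cases i
    · refine ih (sf.dd _) (hf.2 _) hp (hl' 0) h00 ?_
      exact (iterate_dd_congr (dd_comm_eventually sf) n).self_of_nhds.trans h01
    · refine ih (sf.dd _) (hf.2 _) hp (hl' 1) h01 ?_
      have e : dd (b 1) (dd (b 1) f) =ᶠ[𝓝 p] fun y =>
          (dd (b 0) (dd (b 0) f) y + dd (b 1) (dd (b 1) f) y) - dd (b 0) (dd (b 0) f) y :=
        Eventually.of_forall fun y => by ring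
      refine (iterate_dd_congr e n).self_of_nhds.trans ?_
      rw [iterate_dd_sub (((sf.dd _).dd _).add ((sf.dd _).dd _)) ((sf.dd _).dd _),
        hl.iterate_dd_eq_zero, zero_sub, neg_eq_zero]
      exact h00
    · exact h2

theorem Van.dd_center (hf : Hom0 f) (sf : Sm f p) (h : Van k f p) : Van k (dd p f) p := by
  cases k with
  | zero => trivial
  | succ k =>
    let b := EuclideanSpace.basisFun (Fin 3) ℝ
    have hs : ∀ i, Sm (fun y => ⟪y, b i⟫ - ⟪p, b i⟫) p := fun i =>
      (Sm.inner_left (b i)).sub (Sm.const _)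
    have h1 : Van (k + 1) (fun y => ∑ i, (⟪y, b i⟫ - ⟪p, b i⟫) * dd (b i) f y) p := by
      refine Van.sum (fun i _ => (hs i).mul (sf.dd _)) fun i _ => ?_
      exact Van.mul (i := 1) (hs i) (sf.dd _) ⟨by simp, fun _ => trivial⟩ (h.2 _) (by omega)
    refine (h1.neg (Sm.sum fun i _ => (hs i).mul (sf.dd _))).congr ?_
    filter_upwards [sf.nhds] with y hy
    have e1 := MeanField.Hom0.euler hf hy
    rw [dd_basis b f y y] at e1
    rw [dd_basis b f p y]
    simp only [sub_mul, Finset.sum_sub_distrib, real_inner_comm _ (b _)]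
    simp only [real_inner_comm _ (b _)] at e1
    rw [e1]; ring

theorem Sol.van_succ (h1 : Sol u₁) (h2 : Sol u₂) (b : OrthonormalBasis (Fin 3) ℝ E3)
    (h : Van (n + 1) (fun y => u₁ y - u₂ y) (b 2))
    (h00 : (dd (b 0))^[n + 1] (fun y => u₁ y - u₂ y) (b 2) = 0)
    (h01 : (dd (b 0))^[n] (dd (b 1) fun y => u₁ y - u₂ y) (b 2) = 0) :
    Van (n + 2) (fun y => u₁ y - u₂ y) (b 2) := by
  have hp0 : b 2 ≠ 0 := b.orthonormal.ne_zero 2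
  have s1 := h1.sm hp0
  have s2 := h2.sm hp0
  have sw : Sm (fun y => u₁ y - u₂ y) (b 2) := s1.sub s2
  have hD := h.dd_center (MeanField.Hom0.sub h1.hom h2.hom) sw
  refine Van.succ_of_harmonic b sw h hD ?_ h00 h01
  have sn : Sm (fun y : E3 => (‖y‖ ^ 2)⁻¹) (b 2) :=
    Sm.comp (φ := fun t => t⁻¹) (by
      filter_upwards [eventually_ne_nhds (by simp : ‖b 2‖ ^ 2 ≠ 0)] with t ht
      exact contDiffAt_inv ℝ ht) Sm.normSq
  have hw : Sm (fun y => (‖y‖ ^ 2)⁻¹ * (-2 * exp (u₁ y + u₂ y))) (b 2) :=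
    sn.mul ((Sm.const (-2)).mul (Sm.comp (eventually_exp _) (s1.add s2)))
  have ss := Sm.comp (eventually_sinh _) sw
  have hv : Van (n + 1) (fun y => (‖y‖ ^ 2)⁻¹ * (-2 * exp (u₁ y + u₂ y)) *
      Real.sinh (u₁ y - u₂ y)) (b 2) :=
    Van.mul (i := 0) hw ss trivial (h.sinh sw) (by omega)
  refine ((hv.of_le (by omega : n ≤ n + 1)).sub (hw.mul ss) ((sw.dd _).dd _)
    (hD.2 (b 2))).congr ?_
  filter_upwards [sw.nhds, eventually_ne_nhds hp0] with y hy hy0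
  have e := lap_eq b hy
  have e2 := h1.lap_sub_eq h2 hy0
  have hn : ‖y‖ ^ 2 ≠ 0 := by simpa using hy0
  rw [e, Fin.sum_univ_three] at e2
  field_simp
  linear_combination e2

end

section

variable {f g : E3 → ℝ} {x p v w z : E3} {u₁ u₂ : E3 → ℝ} {k m n : ℕ}

theorem Van.AA (s1 : Sm u₁ z) (s2 : Sm u₂ z) (h : Van (m + 1) (fun y => u₁ y - u₂ y) z) :
    Van (2 * m + 2) (AA u₁ u₂) z := by
  have sw := s1.sub s2
  refine ⟨by simp [MeanField.AA, h.1], fun v => ?_⟩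
  have hv := Van.mul (k := 2 * m + 1) (Sm.comp (eventually_sinh _) sw) (sw.dd v)
    (h.sinh sw) (h.2 v) (by omega)
  have hv2 := Van.mul (k := 2 * m + 1) (i := 0) (Sm.const 2)
    ((Sm.comp (eventually_sinh _) sw).mul (sw.dd v)) trivial hv (by omega)
  refine hv2.congr ?_
  filter_upwards [s1.nhds, s2.nhds] with y h1 h2
  have hc := Sm.comp (eventually_cosh _) (h1.sub h2)
  change dd v (fun y => 2 * cosh (u₁ y - u₂ y) - 2) y = _
  rw [dd_sub ((Sm.const 2).mul hc) (Sm.const 2), dd_const_mul _ hc, dd_const,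
    dd_comp differentiable_cosh.differentiableAt (h1.sub h2).differentiableAt, Real.deriv_cosh]
  ring

theorem Van.NN (s1 : Sm u₁ z) (s2 : Sm u₂ z)
    (h : Van (m + 1) (fun y => u₁ y - u₂ y) z) : Van (2 * m) (NN u₁ u₂) z := by
  let b := EuclideanSpace.basisFun (Fin 3) ℝ
  have sw := s1.sub s2
  have hw : Sm (fun y => ‖y‖ ^ 2 * exp (-(u₁ y + u₂ y))) z :=
    Sm.normSq.mul (Sm.comp (eventually_exp _) (s1.add s2).neg)
  have hg : Van (2 * m) (gs fun y => u₁ y - u₂ y) z := by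
    refine (Van.sum (F := fun i y => dd (b i) (fun y => u₁ y - u₂ y) y *
      dd (b i) (fun y => u₁ y - u₂ y) y) (s := Finset.univ)
      (fun i _ => (sw.dd _).mul (sw.dd _)) fun i _ =>
      Van.mul (sw.dd _) (sw.dd _) (h.2 (b i)) (h.2 (b i)) (by omega)).congr ?_
    exact Eventually.of_forall fun y => gs_eq b _ y
  exact (Van.mul (i := 0) hw sw.gs trivial hg (by omega)).add (hw.mul sw.gs) (s1.AA s2)
    ((h.AA s1 s2).of_le (by omega))

theorem norm_sub_sq_eq_DD (hx : ‖x‖ = 1) (hz : ‖z‖ = 1) : ‖x - z‖ ^ 2 = 2 * DD z x := by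
  rw [DD_of_norm _ hx, norm_sub_sq_real, hx, hz]; ring

theorem DD_pos_of_ne (hx : ‖x‖ = 1) (hz : ‖z‖ = 1) (h : x ≠ z) : 0 < DD z x := by
  have h1 := norm_sub_sq_eq_DD hx hz
  have h2 : 0 < ‖x - z‖ := norm_pos_iff.2 (sub_ne_zero.2 h)
  nlinarith [pow_pos h2 2]

theorem Sol.exists_local_bound (h1 : Sol u₁) (h2 : Sol u₂) {q : Fin 4 → E3}
    (hq : ∀ j, ‖q j‖ = 1)
    (hv : ∀ j, Van ((Finset.univ.filter fun i => q i = q j).card + 1)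
      (fun y => u₁ y - u₂ y) (q j)) (hz : ‖z‖ = 1) :
    ∃ C : ℝ, 0 ≤ C ∧ ∀ᶠ x in 𝓝 z, ‖x‖ = 1 → NN u₁ u₂ x ≤ C * ∏ j, DD (q j) x := by
  have hz0 := ne_zero_of_norm hz
  have s1 := h1.sm hz0
  have s2 := h2.sm hz0
  set m := (Finset.univ.filter fun i => q i = z).card with hm
  have hV : Van (2 * m) (NN u₁ u₂) z := by
    by_cases h : ∃ j, q j = z
    · obtain ⟨j, rfl⟩ := h
      exact (hv j).NN s1 s2
    · have : m = 0 := by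
        rw [hm, Finset.card_eq_zero, Finset.filter_eq_empty_iff]
        exact fun i _ hi => h ⟨i, hi⟩
      rw [this]; trivial
  obtain ⟨C, hC0, hC⟩ := (hV.isBigO (s1.NN s2)).exists_pos
  set P : E3 → ℝ := fun x => ∏ j ∈ Finset.univ.filter (fun i => ¬ q i = z), DD (q j) x with hP
  have hPz : 0 < P z := Finset.prod_pos fun j hj =>
    DD_pos_of_ne hz (hq j) fun h => (Finset.mem_filter.1 hj).2 h.symm
  have hPc : ContinuousAt P z := by
    refine tendsto_finsetProd _ fun j _ => ?_
    exact (Sm.DD (q j) hz0).differentiableAt.continuousAt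
  refine ⟨C * 2 ^ m / (P z / 2), by positivity, ?_⟩
  filter_upwards [hC.bound, hPc.eventually (lt_mem_nhds (half_lt_self hPz))] with x hx hxP hx1
  have e : ∏ j, DD (q j) x = DD z x ^ m * P x := by
    rw [← Finset.prod_filter_mul_prod_filter_not Finset.univ (fun i => q i = z)]
    congr 1
    rw [hm, ← Finset.prod_const]
    exact Finset.prod_congr rfl fun j hj => by rw [(Finset.mem_filter.1 hj).2]
  rw [Real.norm_of_nonneg (NN_nonneg _ _ _), Real.norm_of_nonneg (by positivity), pow_mul,
    norm_sub_sq_eq_DD hx1 hz, mul_pow] at hx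
  have hD : 0 ≤ DD z x := by
    have := norm_sub_sq_eq_DD hx1 hz
    nlinarith [sq_nonneg ‖x - z‖]
  rw [e]
  calc NN u₁ u₂ x ≤ C * 2 ^ m / (P z / 2) * (DD z x ^ m * (P z / 2)) := by
        rw [div_mul_eq_mul_div, le_div_iff₀ (by positivity)]
        nlinarith
    _ ≤ _ := by gcongr

theorem Sol.exists_bound (h1 : Sol u₁) (h2 : Sol u₂) {q : Fin 4 → E3}
    (hq : ∀ j, ‖q j‖ = 1)
    (hv : ∀ j, Van ((Finset.univ.filter fun i => q i = q j).card + 1)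
      (fun y => u₁ y - u₂ y) (q j)) :
    ∃ C : ℝ, ∀ x, ‖x‖ = 1 → NN u₁ u₂ x ≤ C * ∏ j, DD (q j) x := by
  have hD : ∀ x, ‖x‖ = 1 → 0 ≤ ∏ j, DD (q j) x := fun x hx =>
    Finset.prod_nonneg fun j _ => by
      have := norm_sub_sq_eq_DD hx (hq j)
      nlinarith [sq_nonneg ‖x - q j‖]
  suffices ∃ C : ℝ, ∀ x ∈ S2, ‖x‖ = 1 → NN u₁ u₂ x ≤ C * ∏ j, DD (q j) x by
    obtain ⟨C, hC⟩ := this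
    exact ⟨C, fun x hx => hC x (by simpa [S2] using hx) hx⟩
  refine isCompact_S2.induction_on
    (p := fun s => ∃ C : ℝ, ∀ x ∈ s, ‖x‖ = 1 → NN u₁ u₂ x ≤ C * ∏ j, DD (q j) x)
    ⟨0, by simp⟩ (fun s t hst ⟨C, hC⟩ => ⟨C, fun x hx => hC x (hst hx)⟩)
    (fun s t ⟨C, hC⟩ ⟨C', hC'⟩ => ⟨max C C', fun x hx hx1 => ?_⟩) (fun z hz => ?_)
  · rcases hx with hx | hx
    · exact (hC x hx hx1).trans (mul_le_mul_of_nonneg_right (le_max_left _ _) (hD x hx1))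
    · exact (hC' x hx hx1).trans (mul_le_mul_of_nonneg_right (le_max_right _ _) (hD x hx1))
  · obtain ⟨C, -, hC⟩ := h1.exists_local_bound h2 hq hv (by simpa [S2] using hz : ‖z‖ = 1)
    exact ⟨_, mem_nhdsWithin_of_mem_nhds hC, C, fun x hx => hx⟩

theorem Sol.eq_of_van (h1 : Sol u₁) (h2 : Sol u₂) {q : Fin 4 → E3}
    (hq : ∀ j, ‖q j‖ = 1)
    (hv : ∀ j, Van ((Finset.univ.filter fun i => q i = q j).card + 1)
      (fun y => u₁ y - u₂ y) (q j)) (hx : ‖x‖ = 1) : u₁ x = u₂ x := by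
  obtain ⟨C, hC⟩ := h1.exists_bound h2 hq hv
  have hN := h1.NN_eq_zero_of_le h2 hq hC hx
  by_contra hne
  have h3 : 1 < cosh (u₁ x - u₂ x) := one_lt_cosh.2 (sub_ne_zero.2 hne)
  have h4 : 0 ≤ ‖x‖ ^ 2 * exp (-(u₁ x + u₂ x)) * gs (fun z => u₁ z - u₂ z) x := by
    simp only [gs]; positivity
  simp only [NN, AA] at hN
  linarith

end

section

variable {f g u : E3 → ℝ} {x p v w z y q : E3} {k m n : ℕ}

/-! ### Reflections -/

/-- The reflection in the plane orthogonal to `y`, as a linear isometry. -/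
def reflectionIn (y : E3) : E3 ≃ₗᵢ[ℝ] E3 := (Submodule.span ℝ {y})ᗮ.reflection

theorem reflectionIn_apply (hy : ‖y‖ = 1) (x : E3) :
    reflectionIn y x = x - (2 * ⟪x, y⟫) • y := by
  rw [reflectionIn, Submodule.reflection_orthogonal_apply, Submodule.reflection_singleton_apply]
  simp only [hy, real_inner_comm]
  simp [two_mul, add_smul, two_smul]

theorem exists_basis_of_pair (hy : ‖y‖ = 1) (hq : ‖q‖ = 1) (h : ⟪y, q⟫ = 0) :
    ∃ b : OrthonormalBasis (Fin 3) ℝ E3, b 1 = y ∧ b 2 = q := by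
  have ho : Orthonormal ℝ (({1, 2} : Set (Fin 3)).domRestrict ![0, y, q]) := by
    rw [orthonormal_iff_ite]
    rintro ⟨i, rfl | rfl⟩ ⟨j, rfl | rfl⟩ <;>
      simp [hy, hq, h, real_inner_comm, Subtype.ext_iff]
  obtain ⟨b, hb⟩ := ho.exists_orthonormalBasis_extension_of_card_eq (by simp)
  exact ⟨b, hb 1 (by simp), hb 2 (by simp)⟩

theorem inner_basis (b : OrthonormalBasis (Fin 3) ℝ E3) (i j : Fin 3) :
    ⟪b i, b j⟫ = if i = j then (1 : ℝ) else 0 := orthonormal_iff_ite.1 b.orthonormal i j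

theorem reflectionIn_of_inner_eq_zero (hy : ‖y‖ = 1) (h : ⟪x, y⟫ = 0) :
    reflectionIn y x = x := by
  rw [reflectionIn_apply hy, h]; simp

theorem reflectionIn_self (hy : ‖y‖ = 1) : reflectionIn y y = -y := by
  rw [reflectionIn_apply hy, real_inner_self_eq_norm_sq, hy]; module

theorem iterate_dd_comp_isometry {R : E3 ≃ₗᵢ[ℝ] E3} (hR : R v = v) (f : E3 → ℝ) (n : ℕ) (x : E3) :
    (dd v)^[n] (fun y => f (R y)) x = (dd v)^[n] f (R x) := by
  induction n generalizing f with
  | zero => rfl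
  | succ n ih =>
    rw [Function.iterate_succ_apply, dd_comp_isometry, hR, ih]
    rfl

theorem iterate_dd_neg (sf : Sm f p) (n : ℕ) :
    (dd v)^[n] (fun y => -f y) p = -(dd v)^[n] f p := by
  have : (dd v)^[n] (fun _ => (0 : ℝ)) p = 0 := Van.zero.iterate_dd_eq_zero
  have h2 := iterate_dd_sub (v := v) (Sm.const 0) sf n
  simpa [this] using h2

theorem Sol.van_reflectionIn (h : Sol u) (b : OrthonormalBasis (Fin 3) ℝ E3)
    (hk : ∀ k < n, (dd (b 0))^[k] (dd (b 1) u) (b 2) = 0) :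
    Van (n + 1) (fun y => u y - u (reflectionIn (b 1) y)) (b 2) := by
  have hR0 : reflectionIn (b 1) (b 0) = b 0 :=
    reflectionIn_of_inner_eq_zero (b.orthonormal.norm_eq_one 1) (by simp)
  have hR2 : reflectionIn (b 1) (b 2) = b 2 :=
    reflectionIn_of_inner_eq_zero (b.orthonormal.norm_eq_one 1) (by simp)
  have hR1 : reflectionIn (b 1) (b 1) = -b 1 := reflectionIn_self (b.orthonormal.norm_eq_one 1)
  have s := h.sm (b.orthonormal.ne_zero 2)
  have sR : Sm (fun y => u (reflectionIn (b 1) y)) (b 2) :=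
    Sm.comp_isometry _ (by rwa [hR2])
  induction n with
  | zero => exact ⟨by simp [hR2], fun _ => trivial⟩
  | succ n ih =>
    refine h.van_succ (h.comp_isometry _) b (ih fun k hkn => hk k (by omega)) ?_ ?_
    · rw [iterate_dd_sub s sR, iterate_dd_comp_isometry hR0, hR2, sub_self]
    · have e : dd (b 1) (fun y => u y - u (reflectionIn (b 1) y)) =ᶠ[𝓝 (b 2)] fun y =>
          dd (b 1) u y - (fun z => -dd (b 1) u (reflectionIn (b 1) z)) y := by
        filter_upwards [s.nhds, sR.nhds] with y hy hy'
        rw [dd_sub hy hy', dd_comp_isometry, hR1]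
        simp [dd]
      have s3 : Sm (fun z => dd (b 1) u (reflectionIn (b 1) z)) (b 2) :=
        Sm.comp_isometry _ (by rw [hR2]; exact s.dd _)
      rw [(iterate_dd_congr e n).self_of_nhds, iterate_dd_sub (s.dd _) s3.neg, iterate_dd_neg s3,
        iterate_dd_comp_isometry hR0, hR2, hk n (by omega)]
      simp

/-! ### Umbilical critical points -/

/-- Umbilical critical points on the unit sphere, expressed through directional derivatives. -/
structure Umb (u : E3 → ℝ) (p : E3) : Prop where
  norm : ‖p‖ = 1
  crit : ∀ v, dd v u p = 0
  hess : ∃ c : ℝ, ∀ v, ⟪v, p⟫ = 0 → dd v (dd v u) p = c * ‖v‖ ^ 2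

theorem dd_dd_vadd (sf : Sm f p) (v w : E3) :
    dd (v + w) (dd (v + w) f) p =
      dd v (dd v f) p + dd w (dd w f) p + 2 * dd v (dd w f) p := by
  have e : dd (v + w) f = fun y => dd v f y + dd w f y := funext fun y => dd_vadd f v w y
  rw [e, dd_vadd, dd_add (sf.dd _) (sf.dd _), dd_add (sf.dd _) (sf.dd _),
    dd_comm (v := w) (w := v) sf]
  ring

theorem Umb.mixed (h : Umb u p) (s : Sm u p) (hv : ⟪v, p⟫ = 0) (hw : ⟪w, p⟫ = 0)
    (hvw : ⟪v, w⟫ = 0) : dd v (dd w u) p = 0 := by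
  obtain ⟨c, hc⟩ := h.hess
  have h1 := hc (v + w) (by rw [inner_add_left, hv, hw, add_zero])
  rw [dd_dd_vadd s, hc v hv, hc w hw, norm_add_sq_real, hvw] at h1
  linarith

/-! ### A one-variable lemma -/

theorem isLittleO_of_deriv {h h' : ℝ → ℝ} (h0 : h 0 = 0)
    (hd : ∀ᶠ s in 𝓝 (0 : ℝ), HasDerivAt h (h' s) s) (ho : h' =o[𝓝 0] fun s => s ^ k) :
    h =o[𝓝 0] fun s => s ^ (k + 1) := by
  refine Asymptotics.IsLittleO.of_bound fun c hc => ?_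
  obtain ⟨r, hr, hball⟩ := Metric.eventually_nhds_iff_ball.1 (hd.and (ho.bound hc))
  filter_upwards [Metric.ball_mem_nhds 0 hr] with s hs
  have hsub : Metric.closedBall (0 : ℝ) |s| ⊆ Metric.ball 0 r :=
    Metric.closedBall_subset_ball (by simpa using hs)
  have := Convex.norm_image_sub_le_of_norm_hasDerivWithin_le (f := h) (f' := h')
    (C := c * |s| ^ k) (x := 0) (y := s)
    (fun t ht => (hball t (hsub ht)).1.hasDerivWithinAt) (fun t ht => ?_)
    (convex_closedBall (0 : ℝ) |s|) (by simp) (by simp)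
  · rw [h0, sub_zero, sub_zero] at this
    simpa [pow_succ, mul_assoc] using this
  · refine (hball t (hsub ht)).2.trans ?_
    have ht' : |t| ≤ |s| := by simpa using ht
    rw [norm_pow, Real.norm_eq_abs]
    gcongr

theorem third_deriv_eq_zero_of_sign {g₀ g₁ g₂ : ℝ → ℝ} {c : ℝ} (h0 : g₀ 0 = 0) (h1 : g₁ 0 = 0)
    (h2 : g₂ 0 = 0) (d0 : ∀ᶠ s in 𝓝 (0 : ℝ), HasDerivAt g₀ (g₁ s) s)
    (d1 : ∀ᶠ s in 𝓝 (0 : ℝ), HasDerivAt g₁ (g₂ s) s) (d2 : HasDerivAt g₂ c 0)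
    (hs : ∀ᶠ s in 𝓝 (0 : ℝ), 0 ≤ g₀ s * g₀ (-s)) : c = 0 := by
  have o2 : (fun s => g₂ s - c * s) =o[𝓝 0] fun s => s ^ 1 := by
    simpa [h2, mul_comm] using d2.isLittleO
  have o1 := isLittleO_of_deriv (h := fun s => g₁ s - c / 2 * s ^ 2)
    (by simp [h1]) (by
      filter_upwards [d1] with s hs
      have := hs.sub (((hasDerivAt_id s).pow 2).const_mul (c / 2))
      exact this.congr_deriv (by simp; ring)) o2
  have o0 := isLittleO_of_deriv (h := fun s => g₀ s - c / 6 * s ^ 3)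
    (by simp [h0]) (by
      filter_upwards [d0] with s hs
      have := hs.sub (((hasDerivAt_id s).pow 3).const_mul (c / 6))
      exact this.congr_deriv (by simp; ring)) o1
  by_contra hc
  have hc6 : 0 < |c| / 12 := by positivity
  have e1 := o0.bound hc6
  have e2 := (show Tendsto (fun s : ℝ => -s) (𝓝 0) (𝓝 0) by
    simpa using (continuous_neg.tendsto (0 : ℝ))).eventually e1
  obtain ⟨s, ⟨⟨hs1, hs2⟩, hs3⟩, hs0⟩ :=
    (((e1.and e2).and hs).filter_mono nhdsWithin_le_nhds |>.and
      (self_mem_nhdsWithin : Set.Ioi (0 : ℝ) ∈ 𝓝[>] 0)).exists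
  have hs0 : 0 < s := hs0
  have hp : 0 < s ^ 3 := by positivity
  have en : (-s) ^ 3 = -s ^ 3 := by ring
  simp only [en, norm_neg, Real.norm_eq_abs, abs_of_pos hp, Nat.reduceAdd] at hs1 hs2
  rw [abs_le] at hs1 hs2
  rcases lt_or_gt_of_ne hc with hc | hc
  · rw [abs_of_neg hc] at hs1 hs2
    nlinarith [mul_pos_of_neg_of_neg hc hc, mul_pos (neg_pos.2 hc) hp]
  · rw [abs_of_pos hc] at hs1 hs2
    nlinarith [mul_pos hc hc, mul_pos hc hp]

end

section

variable {f g u : E3 → ℝ} {x p v w z y q e : E3} {k m n : ℕ}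

theorem hasDerivAt_line {s : ℝ} (h : Sm f (p + s • e)) :
    HasDerivAt (fun t : ℝ => f (p + t • e)) (dd e f (p + s • e)) s := by
  have h1 : HasDerivAt (fun t : ℝ => p + t • e) e s := by
    simpa using ((hasDerivAt_id s).smul_const e).const_add p
  exact h.differentiableAt.hasFDerivAt.comp_hasDerivAt s h1

theorem Sol.eq_reflectionIn (h : Sol u) (b : OrthonormalBasis (Fin 3) ℝ E3) (hu : Umb u (b 2))
    (h3 : dd (b 0) (dd (b 0) (dd (b 1) u)) (b 2) = 0) (hx : ‖x‖ = 1) :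
    u x = u (reflectionIn (b 1) x) := by
  have hb : ∀ i, ‖b i‖ = 1 := b.orthonormal.norm_eq_one
  have s2 := h.sm (b.orthonormal.ne_zero 2)
  have hk : ∀ k < 3, (dd (b 0))^[k] (dd (b 1) u) (b 2) = 0 := fun k hk => by
    interval_cases k
    · exact hu.crit _
    · exact hu.mixed s2 (by simp) (by simp) (by simp)
    · exact h3
  have hR := h.comp_isometry (reflectionIn (b 1))
  by_cases hq : ∃ q : E3, ‖q‖ = 1 ∧ ⟪b 1, q⟫ = 0 ∧ q ≠ b 2 ∧ dd (b 1) u q = 0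
  · obtain ⟨q, hq1, hq2, hne, hq0⟩ := hq
    obtain ⟨b', hb1, hb2⟩ := exists_basis_of_pair (hb 1) hq1 hq2
    have vq := h.van_reflectionIn (n := 1) b' fun k hk => by
      interval_cases k
      rw [hb1, hb2]; exact hq0
    rw [hb1, hb2] at vq
    have vp := h.van_reflectionIn b hk
    refine h.eq_of_van hR (q := ![b 2, b 2, b 2, q]) (fun j => ?_) (fun j => ?_) hx
    · fin_cases j <;> simp [hq1]
    · rw [Finset.card_filter, Fin.sum_univ_four]
      fin_cases j <;> simp [hne, hne.symm, vp, vq]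
  · push Not at hq
    have hne0 : ∀ s t : ℝ, t ≠ 0 ∨ s ≠ 0 → t • b 2 + s • b 0 ≠ 0 := fun s t hst h0 => by
      have e1 := congrArg (fun z => ⟪z, b 2⟫) h0
      have e2 := congrArg (fun z => ⟪z, b 0⟫) h0
      simp [inner_add_left, inner_smul_left] at e1 e2
      tauto
    have hN : ∀ s t : ℝ, (s ≠ 0 ∨ t < 0) → dd (b 1) u (t • b 2 + s • b 0) ≠ 0 :=
      fun s t hst h0 => by
        have hz := hne0 s t (hst.symm.imp_left ne_of_lt)
        have hzn := norm_pos_iff.2 hz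
        refine hq (‖t • b 2 + s • b 0‖⁻¹ • (t • b 2 + s • b 0)) (norm_smul_inv_norm hz) ?_ ?_ ?_
        · simp [inner_add_right, inner_smul_right]
        · intro e
          have e1 := congrArg (fun z => ⟪z, b 2⟫) e
          have e2 := congrArg (fun z => ⟪z, b 0⟫) e
          simp [inner_add_left, inner_smul_left] at e1 e2
          have hs : s = 0 := e2.resolve_left hz
          have ht := hst.resolve_left (not_not.2 hs)
          have := mul_neg_of_pos_of_neg (inv_pos.2 hzn) ht
          linarith
        · rw [MeanField.Hom0.dd_smul h.hom (inv_pos.2 hzn), h0, mul_zero]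
    have hsm : ∀ s : ℝ, Sm u (b 2 + s • b 0) := fun s =>
      h.sm (by simpa using hne0 s 1 (Or.inl one_ne_zero))
    have hsign : ∀ s : ℝ, 0 ≤ dd (b 1) u (b 2 + s • b 0) * dd (b 1) u (b 2 + (-s) • b 0) :=
      fun s => by
        rcases eq_or_ne s 0 with rfl | hs
        · simpa using mul_self_nonneg _
        have hc : Continuous fun t : ℝ => dd (b 1) u ((2 * t ^ 2 - 1) • b 2 + (t * s) • b 0) := by
          refine continuous_iff_continuousAt.2 fun t => ?_
          have h1 : (2 * t ^ 2 - 1) • b 2 + (t * s) • b 0 ≠ 0 := by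
            refine hne0 _ _ ?_
            rcases eq_or_ne t 0 with rfl | ht
            · left; norm_num
            · right; exact mul_ne_zero ht hs
          exact ContinuousAt.comp
            (f := fun t : ℝ => (2 * t ^ 2 - 1) • b 2 + (t * s) • b 0)
            ((h.sm h1).dd _).differentiableAt.continuousAt (by fun_prop)
        have hz : ∀ t : ℝ, dd (b 1) u ((2 * t ^ 2 - 1) • b 2 + (t * s) • b 0) ≠ 0 := fun t => by
          refine hN _ _ ?_
          rcases eq_or_ne t 0 with rfl | ht
          · right; norm_num
          · left; exact mul_ne_zero ht hs
        by_contra hneg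
        push Not at hneg
        have e1 : (2 * (1 : ℝ) ^ 2 - 1) • b 2 + (1 * s) • b 0 = b 2 + s • b 0 := by
          norm_num
        have e2 : (2 * (-1 : ℝ) ^ 2 - 1) • b 2 + (-1 * s) • b 0 = b 2 + (-s) • b 0 := by
          norm_num
        have hmem : (0 : ℝ) ∈ Set.range fun t : ℝ =>
            dd (b 1) u ((2 * t ^ 2 - 1) • b 2 + (t * s) • b 0) := by
          rcases mul_neg_iff.1 hneg with ⟨ha, hb⟩ | ⟨ha, hb⟩
          · exact mem_range_of_exists_le_of_exists_ge hc ⟨-1, by rw [e2]; exact hb.le⟩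
              ⟨1, by rw [e1]; exact ha.le⟩
          · exact mem_range_of_exists_le_of_exists_ge hc ⟨1, by rw [e1]; exact ha.le⟩
              ⟨-1, by rw [e2]; exact hb.le⟩
        obtain ⟨t, ht⟩ := hmem
        exact hz t ht
    have h4 : (dd (b 0))^[3] (dd (b 1) u) (b 2) = 0 := by
      have hd2 := hasDerivAt_line (s := 0) ((((hsm 0).dd (b 1)).dd (b 0)).dd (b 0))
      refine third_deriv_eq_zero_of_sign
        (g₀ := fun s => dd (b 1) u (b 2 + s • b 0))
        (g₁ := fun s => dd (b 0) (dd (b 1) u) (b 2 + s • b 0))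
        (g₂ := fun s => dd (b 0) (dd (b 0) (dd (b 1) u)) (b 2 + s • b 0))
        ?_ ?_ ?_ (Eventually.of_forall fun s => hasDerivAt_line ((hsm s).dd (b 1)))
        (Eventually.of_forall fun s => hasDerivAt_line (((hsm s).dd (b 1)).dd (b 0)))
        (by simpa using! hd2) (Eventually.of_forall hsign)
      · simpa using hk 0 (by norm_num)
      · simpa using hk 1 (by norm_num)
      · simpa using h3
    have vp := h.van_reflectionIn (n := 4) b fun k hk4 => by
      rcases Nat.lt_succ_iff_lt_or_eq.1 hk4 with h5 | rfl
      · exact hk k h5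
      · exact h4
    refine h.eq_of_van hR (q := fun _ => b 2) (fun j => hb 2) (fun j => ?_) hx
    simpa using vp

end

section

variable {f g u : E3 → ℝ} {x p v w z y q e : E3} {k m n : ℕ}

/-! ### Third derivatives at an umbilical point -/

theorem dd_lin (c s : ℝ) (v w : E3) (f : E3 → ℝ) :
    dd (c • v + s • w) f = fun x => c * dd v f x + s * dd w f x := by
  funext x; rw [dd_vadd, dd_smul, dd_smul]

theorem dd_dd_lin (sf : Sm f p) (c s : ℝ) (z v w : E3) :
    dd z (dd (c • v + s • w) f) p = c * dd z (dd v f) p + s * dd z (dd w f) p := by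
  rw [dd_lin, dd_add ((Sm.const c).mul (sf.dd v)) ((Sm.const s).mul (sf.dd w)),
    dd_const_mul _ (sf.dd v), dd_const_mul _ (sf.dd w)]

theorem dd_dd_comm (sf : Sm f p) (x y z : E3) :
    dd x (dd y (dd z f)) p = dd x (dd z (dd y f)) p := dd_congr_at (dd_comm_eventually sf)

theorem dd_dd_self (hf : Hom0 f) (sf : Sm f p) (v : E3) :
    dd p (dd p (dd v f)) p = 2 * dd v f p := by
  have h1 := dd_self_of_homogeneous (φ := fun r => r⁻¹ * r⁻¹) (φ' := -2) (f := dd p (dd v f))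
    (x := p) (by
      have := (hasDerivAt_inv (one_ne_zero (α := ℝ))).mul (hasDerivAt_inv (one_ne_zero (α := ℝ)))
      exact this.congr_deriv (by norm_num))
    ((sf.dd _).dd _).differentiableAt fun r hr => MeanField.Hom0.dd_dd_smul hf hr p v p
  rw [h1, MeanField.Hom0.euler_dd hf sf]; ring

theorem Sol.third_trace (h : Sol u) (b : OrthonormalBasis (Fin 3) ℝ E3) (hu : Umb u (b 2))
    (hv : ⟪b 2, v⟫ = 0) :
    dd (b 0) (dd (b 0) (dd v u)) (b 2) + dd (b 1) (dd (b 1) (dd v u)) (b 2) = 0 := by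
  have hp := b.orthonormal.ne_zero 2
  have s := h.sm hp
  have h1 := lap_dd (v := v) s
  have h2 : dd v (fun y => ‖y‖ ^ 2 * lap u y) (b 2) = dd v (fun y => 3 - exp (2 * u y)) (b 2) := by
    refine dd_congr_at ?_
    filter_upwards [eventually_ne_nhds hp] with y hy using h.eq y hy
  have se := (Sm.const 2).mul s
  rw [dd_mul Sm.normSq s.lap, dd_normSq, hv, hu.norm,
    dd_sub (Sm.const _) (Sm.comp (eventually_exp _) se), dd_const,
    dd_comp differentiable_exp.differentiableAt se.differentiableAt, dd_const_mul _ s,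
    hu.crit] at h2
  rw [lap_eq b (s.dd v), Fin.sum_univ_three, dd_dd_self h.hom s, hu.crit] at h1
  linarith

theorem exists_rotated_basis (b : OrthonormalBasis (Fin 3) ℝ E3) {c s : ℝ} (h : c ^ 2 + s ^ 2 = 1) :
    ∃ b' : OrthonormalBasis (Fin 3) ℝ E3, b' 0 = c • b 0 + s • b 1 ∧
      b' 1 = (-s) • b 0 + c • b 1 ∧ b' 2 = b 2 := by
  have hn : ∀ α β : ℝ, α ^ 2 + β ^ 2 = 1 → ‖α • b 0 + β • b 1‖ = 1 := fun α β hab => by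
    rw [← sq_eq_sq₀ (norm_nonneg _) zero_le_one, norm_add_sq_real, norm_smul, norm_smul,
      inner_smul_left, inner_smul_right]
    simp [hab]
  have hn' : ‖-(s • b 0) + c • b 1‖ = 1 := by simpa using hn (-s) c (by linarith)
  have ho : Orthonormal ℝ ((Set.univ : Set (Fin 3)).domRestrict
      ![c • b 0 + s • b 1, (-s) • b 0 + c • b 1, b 2]) := by
    rw [orthonormal_iff_ite]
    rintro ⟨i, -⟩ ⟨j, -⟩
    fin_cases i <;> fin_cases j <;>
      simp [inner_add_left, inner_add_right, inner_smul_left, inner_smul_right,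
        Subtype.ext_iff, hn c s h, hn'] <;> ring
  obtain ⟨b', hb⟩ := ho.exists_orthonormalBasis_extension_of_card_eq (by simp)
  exact ⟨b', hb 0 trivial, hb 1 trivial, hb 2 trivial⟩

theorem Sol.third_rotated (h : Sol u) (b : OrthonormalBasis (Fin 3) ℝ E3) (hu : Umb u (b 2))
    (c s : ℝ) :
    dd (c • b 0 + s • b 1) (dd (c • b 0 + s • b 1) (dd ((-s) • b 0 + c • b 1) u)) (b 2) =
      (s ^ 3 - 3 * c ^ 2 * s) * dd (b 0) (dd (b 0) (dd (b 0) u)) (b 2) +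
      (c ^ 3 - 3 * c * s ^ 2) * dd (b 0) (dd (b 0) (dd (b 1) u)) (b 2) := by
  have sm := h.sm (b.orthonormal.ne_zero 2)
  have t0 := h.third_trace b hu (v := b 0) (by simp)
  have t1 := h.third_trace b hu (v := b 1) (by simp)
  have e1 : ∀ x z, dd x (dd (c • b 0 + s • b 1) (dd z u)) (b 2) =
      c * dd x (dd (b 0) (dd z u)) (b 2) + s * dd x (dd (b 1) (dd z u)) (b 2) :=
    fun x z => dd_dd_lin (sm.dd _) c s x _ _
  have e2 : ∀ x y, dd x (dd y (dd ((-s) • b 0 + c • b 1) u)) (b 2) =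
      -s * dd x (dd y (dd (b 0) u)) (b 2) + c * dd x (dd y (dd (b 1) u)) (b 2) := fun x y => by
    rw [dd_dd_comm sm, dd_dd_lin (sm.dd _), dd_dd_comm sm x (b 0), dd_dd_comm sm x (b 1)]
  rw [dd_vadd, dd_smul, dd_smul, e1, e1]
  simp only [e2]
  rw [dd_dd_comm sm (b 0) (b 1) (b 0), dd_comm (v := b 1) (w := b 0) (sm.dd (b 0)),
    dd_comm (v := b 1) (w := b 0) (sm.dd (b 1)), dd_dd_comm sm (b 0) (b 1) (b 0)]
  have hc : dd (b 1) (dd (b 1) (dd (b 0) u)) (b 2) = dd (b 0) (dd (b 1) (dd (b 1) u)) (b 2) := by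
    rw [dd_dd_comm sm (b 1) (b 1) (b 0), dd_comm (v := b 1) (w := b 0) (sm.dd (b 1))]
  linear_combination c * s ^ 2 * t1 + 2 * c ^ 2 * s * (t0 - hc) - s ^ 3 * t0

theorem exists_angle (A B : ℝ) : ∃ c s : ℝ, c ^ 2 + s ^ 2 = 1 ∧
    (s ^ 3 - 3 * c ^ 2 * s) * A + (c ^ 3 - 3 * c * s ^ 2) * B = 0 := by
  set z : ℂ := ⟨A, B⟩ with hz
  have hA : ‖z‖ * cos z.arg = A := Complex.norm_mul_cos_arg z
  have hB : ‖z‖ * sin z.arg = B := Complex.norm_mul_sin_arg z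
  refine ⟨cos (z.arg / 3), sin (z.arg / 3), cos_sq_add_sin_sq _, ?_⟩
  have h1 : cos z.arg = cos (3 * (z.arg / 3)) := by ring_nf
  have h2 : sin z.arg = sin (3 * (z.arg / 3)) := by ring_nf
  have h3 := cos_sq_add_sin_sq (z.arg / 3)
  rw [cos_three_mul] at h1
  rw [sin_three_mul] at h2
  rw [← hA, ← hB, h1, h2]
  generalize cos (z.arg / 3) = c at *
  generalize sin (z.arg / 3) = s at *
  have hs : s ^ 2 = 1 - c ^ 2 := by linarith
  have e1 : s ^ 3 - 3 * c ^ 2 * s = -(3 * s - 4 * s ^ 3) := by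
    linear_combination -3 * s * h3
  have e2 : c ^ 3 - 3 * c * s ^ 2 = 4 * c ^ 3 - 3 * c := by
    linear_combination -3 * c * h3
  rw [e1, e2]; ring

/-- An orthonormal basis adapted to the third derivative at an umbilical point. -/
theorem Sol.exists_adapted_basis (h : Sol u) (hu : Umb u p) :
    ∃ b : OrthonormalBasis (Fin 3) ℝ E3, b 2 = p ∧
      dd (b 0) (dd (b 0) (dd (b 1) u)) p = 0 := by
  obtain ⟨b, rfl⟩ := exists_basis_last hu.norm
  obtain ⟨c, s, hcs, hz⟩ := exists_angle (dd (b 0) (dd (b 0) (dd (b 0) u)) (b 2))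
    (dd (b 0) (dd (b 0) (dd (b 1) u)) (b 2))
  obtain ⟨b', h0, h1, h2⟩ := exists_rotated_basis b hcs
  refine ⟨b', h2, ?_⟩
  rw [h0, h1, h.third_rotated b hu c s, hz]

/-! ### The antipodal point -/

theorem reflectionIn_neg_basis (b : OrthonormalBasis (Fin 3) ℝ E3) :
    reflectionIn (b 1) (-b 2) = -b 2 := by
  rw [map_neg, reflectionIn_of_inner_eq_zero (b.orthonormal.norm_eq_one 1) (by simp)]

theorem Sol.eq_comp_reflectionIn (h : Sol u) (b : OrthonormalBasis (Fin 3) ℝ E3)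
    (hs : ∀ x, ‖x‖ = 1 → u x = u (reflectionIn (b 1) x)) :
    u = fun x => u (reflectionIn (b 1) x) := by
  funext x
  rcases eq_or_ne x 0 with rfl | hx
  · simp
  · have hn := norm_pos_iff.2 hx
    have h1 := hs (‖x‖⁻¹ • x) (by simpa using norm_smul_inv_norm (𝕜 := ℝ) hx)
    rw [map_smul, h.hom _ _ (inv_pos.2 hn), h.hom _ _ (inv_pos.2 hn)] at h1
    exact h1

theorem Sol.crit_neg_of_symm (h : Sol u) (b : OrthonormalBasis (Fin 3) ℝ E3)
    (hs : ∀ x, ‖x‖ = 1 → u x = u (reflectionIn (b 1) x)) :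
    dd (b 1) u (-b 2) = 0 ∧ dd (b 0) (dd (b 1) u) (-b 2) = 0 := by
  have e := h.eq_comp_reflectionIn b hs
  have s := h.sm (neg_ne_zero.2 (b.orthonormal.ne_zero 2))
  have hR1 := reflectionIn_self (b.orthonormal.norm_eq_one 1)
  have hR0 : reflectionIn (b 1) (b 0) = b 0 :=
    reflectionIn_of_inner_eq_zero (b.orthonormal.norm_eq_one 1) (by simp)
  have e1 : dd (b 1) u = fun x => -dd (b 1) u (reflectionIn (b 1) x) := by
    conv_lhs => rw [e]
    rw [dd_comp_isometry, hR1]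
    simp [dd]
  have e0 : dd (b 0) (dd (b 1) u) (-b 2) = -dd (b 0) (dd (b 1) u) (-b 2) := by
    conv_lhs => rw [e1]
    rw [dd_neg, dd_comp_isometry, hR0]
    beta_reduce
    rw [reflectionIn_neg_basis]
  refine ⟨?_, by linarith⟩
  have := congrFun e1 (-b 2)
  simp only [reflectionIn_neg_basis] at this
  linarith

theorem Sol.umb_neg (h : Sol u) (hu : Umb u p) : Umb u (-p) := by
  obtain ⟨b, rfl, hb⟩ := h.exists_adapted_basis hu
  have s := h.sm (neg_ne_zero.2 (b.orthonormal.ne_zero 2))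
  have h3 : √3 ^ 2 = (3 : ℝ) := sq_sqrt (by norm_num)
  obtain ⟨b', r0, r1, r2⟩ := exists_rotated_basis b (c := 1 / 2) (s := √3 / 2) (by nlinarith)
  have hb' : dd (b' 0) (dd (b' 0) (dd (b' 1) u)) (b' 2) = 0 := by
    rw [r0, r1, r2, h.third_rotated b hu, hb]
    linear_combination √3 / 8 * dd (b 0) (dd (b 0) (dd (b 0) u)) (b 2) * h3
  obtain ⟨a1, a2⟩ := h.crit_neg_of_symm b fun x hx => h.eq_reflectionIn b hu hb hx
  obtain ⟨c1, c2⟩ := h.crit_neg_of_symm b' fun x hx =>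
    h.eq_reflectionIn b' (by rwa [r2]) hb' hx
  have h30 : √3 ≠ 0 := by positivity
  rw [r1, r2, dd_vadd, dd_smul, dd_smul, a1] at c1
  rw [r0, r1, r2, dd_dd_lin s, dd_vadd, dd_vadd, dd_smul, dd_smul, dd_smul, dd_smul,
    dd_comm (v := b 1) (w := b 0) s, a2] at c2
  have g0 : dd (b 0) u (-b 2) = 0 := by
    have : √3 * dd (b 0) u (-b 2) = 0 := by linarith
    exact (mul_eq_zero.1 this).resolve_left h30
  have g2 : dd (b 2) u (-b 2) = 0 := by
    have := MeanField.Hom0.euler h.hom s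
    simpa [dd] using this
  have hH : dd (b 1) (dd (b 1) u) (-b 2) = dd (b 0) (dd (b 0) u) (-b 2) := by
    have : √3 * (dd (b 1) (dd (b 1) u) (-b 2) - dd (b 0) (dd (b 0) u) (-b 2)) = 0 := by
      linarith
    exact sub_eq_zero.1 ((mul_eq_zero.1 this).resolve_left h30)
  refine ⟨by simp, fun v => ?_, dd (b 0) (dd (b 0) u) (-b 2), fun v hv => ?_⟩
  · rw [dd_basis b, Fin.sum_univ_three, g0, a1, g2]; ring
  · have ev : v = ⟪b 0, v⟫ • b 0 + ⟪b 1, v⟫ • b 1 := by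
      have := b.sum_repr' v
      rw [Fin.sum_univ_three, real_inner_comm v (b 2), show ⟪v, b 2⟫ = 0 by simpa using hv] at this
      simpa using this.symm
    have en := b.sum_sq_norm_inner_right v
    rw [Fin.sum_univ_three, real_inner_comm v (b 2), show ⟪v, b 2⟫ = 0 by simpa using hv] at en
    simp only [Real.norm_eq_abs, sq_abs] at en
    rw [← en]
    conv_lhs => rw [ev]
    rw [dd_dd_lin s, dd_vadd, dd_vadd, dd_smul, dd_smul, dd_smul, dd_smul,
      dd_comm (v := b 1) (w := b 0) s, a2, hH]
    ring

/-! ### Axial symmetry -/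

theorem Sol.eq_reflectionIn_of_antipodal (h : Sol u) (hp : Umb u p) (hm : Umb u (-p))
    (hy : ‖y‖ = 1) (hyp : ⟪y, p⟫ = 0) (hx : ‖x‖ = 1) : u x = u (reflectionIn y x) := by
  have key : ∀ {q : E3}, Umb u q → ⟪y, q⟫ = 0 →
      Van 3 (fun x => u x - u (reflectionIn y x)) q := fun {q} hq hyq => by
    obtain ⟨b, rfl, rfl⟩ := exists_basis_of_pair hy hq.norm hyq
    refine h.van_reflectionIn (n := 2) b fun k hk => ?_
    interval_cases k
    · exact hq.crit _
    · exact hq.mixed (h.sm (b.orthonormal.ne_zero 2)) (by simp) (by simp) (by simp)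
  have v1 := key hp hyp
  have v2 := key hm (by simpa using hyp)
  have hp1 := hp.norm
  have hne : p ≠ -p := fun e => by
    have := congrArg (fun z => ⟪z, p⟫) e
    simp only [inner_neg_left, real_inner_self_eq_norm_sq, hp1] at this
    norm_num at this
  refine h.eq_of_van (h.comp_isometry (reflectionIn y)) (q := ![p, p, -p, -p])
    (fun j => ?_) (fun j => ?_) hx
  · fin_cases j <;> simp [hp1]
  · rw [Finset.card_filter, Fin.sum_univ_four]
    fin_cases j <;> simp [hne, hne.symm, v1, v2]

theorem Sol.axiallySymmetric (h : Sol u) (hu : Umb u p) (hx : ‖x‖ = 1) (hz : ‖z‖ = 1)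
    (hxz : ⟪x, p⟫ = ⟪z, p⟫) : u x = u z := by
  rcases eq_or_ne x z with rfl | hne
  · rfl
  have hd := sub_ne_zero.2 hne
  have hn := norm_pos_iff.2 hd
  have hy : ‖‖x - z‖⁻¹ • (x - z)‖ = 1 := norm_smul_inv_norm hd
  rw [h.eq_reflectionIn_of_antipodal hu (h.umb_neg hu) hy (x := x)
    (by rw [inner_smul_left, inner_sub_left, hxz, sub_self, mul_zero]) hx, reflectionIn_apply hy]
  congr 1
  have e : ‖x - z‖ ^ 2 = 2 * ⟪x, x - z⟫ := by
    rw [norm_sub_sq_real, inner_sub_right, real_inner_self_eq_norm_sq, hx, hz]; ring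
  rw [inner_smul_right, smul_smul, show 2 * (‖x - z‖⁻¹ * ⟪x, x - z⟫) * ‖x - z‖⁻¹ = 1 by
    field_simp; linarith]
  simp

end

section

variable {f g u : E3 → ℝ} {x p v w z y q e a : E3} {t : ℝ}

/-! ### Axially symmetric solutions -/

theorem hasDerivAt_circle (a v w : E3) (h : Sm f (a + (cos t • v + sin t • w))) :
    HasDerivAt (fun t => f (a + (cos t • v + sin t • w)))
      (-sin t * dd v f (a + (cos t • v + sin t • w)) +
        cos t * dd w f (a + (cos t • v + sin t • w))) t := by
  have h1 : HasDerivAt (fun t => a + (cos t • v + sin t • w)) ((-sin t) • v + cos t • w) t :=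
    (((hasDerivAt_cos t).smul_const v).add ((hasDerivAt_sin t).smul_const w)).const_add a
  have h2 := h.differentiableAt.hasFDerivAt.comp_hasDerivAt t h1
  rw [map_add, map_smul, map_smul] at h2
  exact h2

theorem exists_meridian_basis (b : OrthonormalBasis (Fin 3) ℝ E3) (t : ℝ) :
    ∃ b' : OrthonormalBasis (Fin 3) ℝ E3, b' 0 = (-sin t) • b 2 + cos t • b 0 ∧
      b' 1 = b 1 ∧ b' 2 = cos t • b 2 + sin t • b 0 := by
  obtain ⟨b', h0, h1, h2⟩ := exists_rotated_basis (b.reindex (Equiv.swap 1 2))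
    (c := cos t) (s := -sin t) (by rw [neg_sq, cos_sq_add_sin_sq])
  have e2 : Equiv.swap (1 : Fin 3) 2 0 = 0 := by decide
  have := fun i => b.reindex_apply (Equiv.swap 1 2) i
  simp only [this, Equiv.symm_swap, e2, Equiv.swap_apply_left, Equiv.swap_apply_right, neg_neg]
    at h0 h1 h2
  refine ⟨b'.reindex (Equiv.swap 1 2), ?_, ?_, ?_⟩
  · simp [h0, e2, add_comm]
  · simp [h2]
  · simp [h1, add_comm]

theorem Sol.meridian_ode (h : Sol u) (b : OrthonormalBasis (Fin 3) ℝ E3)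
    (hax : ∀ x z, ‖x‖ = 1 → ‖z‖ = 1 → ⟪x, b 2⟫ = ⟪z, b 2⟫ → u x = u z) :
    ∃ f f' f'' : ℝ → ℝ, (∀ t, f t = u (cos t • b 2 + sin t • b 0)) ∧
      (∀ t, HasDerivAt f (f' t) t) ∧ (∀ t, HasDerivAt f' (f'' t) t) ∧
      ∀ t, 0 < sin t → sin t * f'' t + cos t * f' t = sin t * (3 - exp (2 * f t)) := by
  set γ : ℝ → E3 := fun t => cos t • b 2 + sin t • b 0 with hγ
  have hb : ∀ t, ‖γ t‖ = 1 := fun t => by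
    obtain ⟨b', -, -, h2⟩ := exists_meridian_basis b t
    rw [hγ]; beta_reduce; rw [← h2]; simp
  have hs : ∀ t, Sm u (γ t) := fun t => h.sm (ne_zero_of_norm (hb t))
  have hd : ∀ {F : E3 → ℝ} {t : ℝ}, Sm F (γ t) → HasDerivAt (fun t => F (γ t))
      (-sin t * dd (b 2) F (γ t) + cos t * dd (b 0) F (γ t)) t := fun {F t} hF => by
    simpa using hasDerivAt_circle 0 (b 2) (b 0) (t := t) (by simpa using hF)
  refine ⟨fun t => u (γ t), _, _, fun t => rfl, fun t => hd (hs t), fun t =>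
    ((hasDerivAt_sin t).neg.mul (hd ((hs t).dd _))).add
      ((hasDerivAt_cos t).mul (hd ((hs t).dd _))), fun t ht => ?_⟩
  obtain ⟨b', h0, h1, h2⟩ := exists_meridian_basis b t
  have h2' : b' 2 = γ t := h2
  have s := hs t
  have hcs := sin_sq_add_cos_sq t
  have E := MeanField.Hom0.euler h.hom s
  have E2 : ∀ v, dd (γ t) (dd v u) (γ t) = -dd v u (γ t) := MeanField.Hom0.euler_dd h.hom s
  have L := h.eq (γ t) (ne_zero_of_norm (hb t))
  rw [hb, lap_eq b' s, Fin.sum_univ_three, h2', E2, E, h0, h1, dd_dd_lin s, dd_vadd, dd_vadd,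
    dd_smul, dd_smul, dd_smul, dd_smul] at L
  have E' : cos t * dd (b 2) u (γ t) + sin t * dd (b 0) u (γ t) = 0 := by
    rw [← dd_smul, ← dd_smul, ← dd_vadd]; exact E
  -- Differentiate `u` twice along the circle of latitude through `γ t`.
  have N : sin t * dd (b 1) (dd (b 1) u) (γ t) = dd (b 0) u (γ t) := by
    set Γ : ℝ → E3 := fun θ => cos t • b 2 + (cos θ • (sin t • b 0) + sin θ • (sin t • b 1))
      with hΓ
    have hΓ0 : Γ 0 = γ t := by simp [hΓ, hγ]
    have hΓn : ∀ θ, ‖Γ θ‖ = 1 := fun θ => by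
      have hc := sin_sq_add_cos_sq θ
      rw [← sq_eq_sq₀ (norm_nonneg _) zero_le_one, ← real_inner_self_eq_norm_sq]
      simp only [hΓ, inner_add_left, inner_add_right, real_inner_smul_left,
        real_inner_smul_right, inner_basis]
      simp
      linear_combination sin t ^ 2 * hc + hcs
    have hu0 : ∀ θ, u (Γ θ) = u (γ t) := fun θ => hax _ _ (hΓn θ) (hb t) (by
      simp only [hΓ, hγ, inner_add_left, real_inner_smul_left, inner_basis]; simp)
    have hΓs : ∀ θ, Sm u (Γ θ) := fun θ => h.sm (ne_zero_of_norm (hΓn θ))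
    have d1 : ∀ θ, -sin θ * (sin t * dd (b 0) u (Γ θ)) + cos θ * (sin t * dd (b 1) u (Γ θ)) = 0 :=
      fun θ => by
        have := hasDerivAt_circle (cos t • b 2) (sin t • b 0) (sin t • b 1) (hΓs θ)
        rw [dd_smul, dd_smul] at this
        refine this.unique ?_
        have e : (fun θ => u (Γ θ)) = fun _ => u (γ t) := funext hu0
        exact e ▸ hasDerivAt_const θ _
    have k0 := hasDerivAt_circle (cos t • b 2) (sin t • b 0) (sin t • b 1)
      ((hΓs 0).dd (b 0))
    have k1 := hasDerivAt_circle (cos t • b 2) (sin t • b 0) (sin t • b 1)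
      ((hΓs 0).dd (b 1))
    have d2 := ((hasDerivAt_sin 0).neg.mul (k0.const_mul (sin t))).add
      ((hasDerivAt_cos 0).mul (k1.const_mul (sin t)))
    have d3 := d2.unique ((hasDerivAt_const (0 : ℝ) (0 : ℝ)).congr_of_eventuallyEq
      (Eventually.of_forall d1))
    have e0 : cos t • b 2 + (cos 0 • (sin t • b 0) + sin 0 • (sin t • b 1)) = γ t := hΓ0
    rw [e0] at d3
    simp only [cos_zero, sin_zero, dd_smul, Pi.neg_apply] at d3
    have : sin t * (sin t * dd (b 1) (dd (b 1) u) (γ t) - dd (b 0) u (γ t)) = 0 := by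
      linear_combination d3
    exact sub_eq_zero.1 ((mul_eq_zero.1 this).resolve_left ht.ne')
  simp only [Pi.neg_apply]
  linear_combination sin t * L - N - 2 * sin t * E' + dd (b 0) u (γ t) * hcs

theorem eq_log_of_ode {f f' f'' : ℝ → ℝ} (h1 : ∀ t, HasDerivAt f (f' t) t)
    (h2 : ∀ t, HasDerivAt f' (f'' t) t)
    (ode : ∀ t, 0 < sin t → sin t * f'' t + cos t * f' t = sin t * (3 - exp (2 * f t)))
    (ht : t ∈ Set.Icc 0 π) : f t = log 3 / 2 := by
  set J : ℝ → ℝ := fun t => cos t * sin t ^ 2 * (3 - exp (2 * f t)) +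
    (1 - 3 * cos t ^ 2) * sin t * f' t - cos t * sin t ^ 2 * f' t ^ 2 with hJ
  have dJ : ∀ t, 0 < sin t → HasDerivAt J (sin t ^ 3 * f' t ^ 2) t := fun t hs => by
    have c := hasDerivAt_cos t
    have s := hasDerivAt_sin t
    have := (((c.mul (s.pow 2)).mul (((h1 t).const_mul 2).exp.const_sub 3)).add
      ((((c.pow 2).const_mul 3).const_sub 1).mul s |>.mul (h2 t))).sub
      ((c.mul (s.pow 2)).mul ((h2 t).pow 2))
    refine this.congr_deriv ?_
    have hcs := sin_sq_add_cos_sq t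
    have o := ode t hs
    simp only [Pi.mul_apply, Pi.pow_apply]
    push_cast
    linear_combination (1 - 3 * cos t ^ 2 - 2 * cos t * sin t * f' t) * o -
      sin t * (3 - exp (2 * f t)) * hcs
  have cf : Continuous f := continuous_iff_continuousAt.2 fun t => (h1 t).continuousAt
  have cf' : Continuous f' := continuous_iff_continuousAt.2 fun t => (h2 t).continuousAt
  have cJ : Continuous J := by rw [hJ]; fun_prop
  have hm : MonotoneOn J (Set.Icc 0 π) := by
    refine monotoneOn_of_hasDerivWithinAt_nonneg (convex_Icc 0 π) cJ.continuousOn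
      (f' := fun t => sin t ^ 3 * f' t ^ 2) (fun t ht => ?_) fun t ht => ?_ <;>
      rw [interior_Icc] at ht <;> have := sin_pos_of_mem_Ioo ht
    · exact (dJ t this).hasDerivWithinAt
    · positivity
  have J0 : J 0 = 0 := by simp [hJ]
  have Jπ : J π = 0 := by simp [hJ]
  have Jz : ∀ t ∈ Set.Icc 0 π, J t = 0 := fun t ht => le_antisymm
    (Jπ ▸ hm ht ⟨pi_pos.le, le_rfl⟩ ht.2) (J0 ▸ hm ⟨le_rfl, pi_pos.le⟩ ht ht.1)
  have z1 : ∀ t ∈ Set.Ioo 0 π, f' t = 0 := fun t ht => by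
    have hs := sin_pos_of_mem_Ioo ht
    have : J =ᶠ[𝓝 t] fun _ => 0 := by
      filter_upwards [isOpen_Ioo.mem_nhds ht] with r hr using Jz r (Set.Ioo_subset_Icc_self hr)
    have := (dJ t hs).unique ((hasDerivAt_const t (0 : ℝ)).congr_of_eventuallyEq this)
    simpa [hs.ne'] using this
  have z0 : ∀ t ∈ Set.Ioo 0 π, f t = log 3 / 2 := fun t ht => by
    have hs := sin_pos_of_mem_Ioo ht
    have : f' =ᶠ[𝓝 t] fun _ => 0 := by
      filter_upwards [isOpen_Ioo.mem_nhds ht] with r hr using z1 r hr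
    have e2 := (h2 t).unique ((hasDerivAt_const t (0 : ℝ)).congr_of_eventuallyEq this)
    have o := ode t hs
    rw [e2, z1 t ht, mul_zero, mul_zero, add_zero, eq_comm] at o
    have e3 : exp (2 * f t) = 3 := by linarith [(mul_eq_zero.1 o).resolve_left hs.ne']
    rw [← e3, log_exp]; ring
  have : Set.EqOn f (fun _ => log 3 / 2) (closure (Set.Ioo 0 π)) :=
    Set.EqOn.closure z0 cf continuous_const
  rw [closure_Ioo pi_pos.ne] at this
  exact this ht

theorem Sol.eq_log (h : Sol u) (hu : Umb u p) (hx : ‖x‖ = 1) : u x = log 3 / 2 := by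
  obtain ⟨b, rfl⟩ := exists_basis_last hu.norm
  obtain ⟨f, f', f'', hf, h1, h2, ode⟩ := h.meridian_ode b fun x z hx hz =>
    h.axiallySymmetric hu hx hz
  have hi : |⟪x, b 2⟫| ≤ 1 := by simpa [hx] using abs_real_inner_le_norm x (b 2)
  rw [abs_le] at hi
  rw [← eq_log_of_ode h1 h2 ode ⟨arccos_nonneg ⟪x, b 2⟫, arccos_le_pi _⟩, hf]
  obtain ⟨b', -, -, e⟩ := exists_meridian_basis b (arccos ⟪x, b 2⟫)
  refine h.axiallySymmetric hu hx (by rw [← e]; simp) ?_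
  simp only [inner_add_left, real_inner_smul_left, inner_basis]
  simp [cos_arccos hi.1 hi.2]

end

end

end MeanField

theorem stmt1 (u : E3 → ℝ) (hu : MFE u 3) (p : E3) (hp : p ∈ S2)
    (hump : UmbilicalCritical u p) :
    ∀ x ∈ S2, u x = Real.log 3 / 2 := by
  have h := MeanField.Sol.of_MFE hu
  have hp1 : ‖p‖ = 1 := by simpa [S2] using hp
  obtain ⟨h1, c, h2⟩ := hump
  intro x hx
  refine h.eq_log ⟨hp1, fun v => by simp [MeanField.dd, h1], c, fun v hv => ?_⟩
    (by simpa [S2] using hx)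
  rw [← MeanField.iteratedFDeriv_two_eq (h.sm (MeanField.ne_zero_of_norm hp1)), h2 v hv]
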